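/- arXiv:2301.09473 — 4 statements merged into one kernel-verified Lean document; each statement's English description precedes it below -/
import Mathlib

section
/- Poisson sum rule via Bessonov's formula: Let ζ ∈ 𝔻 and let ν be a nontrivial probability measure on the unit circle 𝕋 with Schur function f. Then K(Pois(ζ) | ν) = log( |1 − ζ·f(ζ)|² / ((1−|ζ|²)(1−|f(ζ)|²)) ) + ∑_{k=1}^∞ log( (1 − |ζ·S₀^{[k]}(f)(ζ)|²) / (1 − |S₀^{[k]}(f)(ζ)|²) ), where all summands on the right-hand side are nonnegative and both sides may be infinite simultaneously. -/
open MeasureTheory Real Filter Set Topology Polynomial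
open scoped ENNReal ComplexConjugate

noncomputable section

namespace SumRules

-- Kullback–Leibler divergence `K(ν | μ)`.
open Classical in
def KLdiv {α : Type*} [MeasurableSpace α] (ν μ : Measure α) : ℝ≥0∞ :=
  if ν ≪ μ ∧ Integrable (llr ν μ) ν then ENNReal.ofReal (∫ x, llr ν μ x ∂ν) else ⊤

/-- The (topological) support of a measure. -/
def suppSet {α : Type*} [TopologicalSpace α] [MeasurableSpace α] (μ : Measure α) : Set α :=
  {x | ∀ U ∈ nhds x, μ U ≠ 0}

/-- A measure is nontrivial if its support is infinite, i.e. it is not carried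
by any finite set. -/
def InfiniteSupport {α : Type*} [MeasurableSpace α] (μ : Measure α) : Prop :=
  ∀ s : Finset α, μ (↑s : Set α)ᶜ ≠ 0

/-- The set of support points outside `[cm, cp]`. -/
def ES (μ : Measure ℝ) (cm cp : ℝ) : Set ℝ := suppSet μ \ Icc cm cp

/-- `μ ∈ 𝒮₁(cm, cp)`: the support of `μ` is contained in `[cm, cp]` together with an
at most countable set of points outside this interval. -/
def InS1 (μ : Measure ℝ) (cm cp : ℝ) : Prop := (ES μ cm cp).Countable

/-- `a b` (indexed so that `a (k+1) = a_{k+1}`, `b (k+1) = b_{k+1}`, `k ≥ 0`) are the Jacobi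
coefficients of `μ`: there is a sequence of orthonormal polynomials (with positive leading
coefficients, obtained by Gram-Schmidt from `1, x, x², …`) satisfying the three-term recursion. -/
def IsJacobi (μ : Measure ℝ) (a b : ℕ → ℝ) : Prop :=
  (∀ k : ℕ, 0 < a (k+1)) ∧
  ∃ p : ℕ → Polynomial ℝ,
    (∀ k, (p k).natDegree = k) ∧ (∀ k, 0 < (p k).leadingCoeff) ∧
    (∀ j k, ∫ x, (p j).eval x * (p k).eval x ∂μ = if j = k then 1 else 0) ∧
    (∀ (k : ℕ) (x : ℝ), x * (p k).eval x =
      a (k+1) * (p (k+1)).eval x + b (k+1) * (p k).eval x +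
        (if k = 0 then 0 else a k * (p (k-1)).eval x))

/-- `u` is the sequence of canonical moments of a measure on `[-2,2]` (with `u 0 = -1`). -/
def IsCanonicalMoments (μ : Measure ℝ) (u : ℕ → ℝ) : Prop :=
  u 0 = -1 ∧ (∀ k : ℕ, u (k+1) ∈ Ioo (-1 : ℝ) 1) ∧
  ∃ a b : ℕ → ℝ, IsJacobi μ a b ∧
    (∀ k : ℕ, b (k+1) = (1 - u (2*k)) * u (2*k+1) - (1 + u (2*k)) * u (2*k-1)) ∧
    (∀ k : ℕ, (a (k+1))^2 = (1 - u (2*k)) * (1 - (u (2*k+1))^2) * (1 + u (2*k+2)))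

/-- `z` is the sequence of canonical coefficients of a measure supported in `[0,∞)`. -/
def IsCanonicalZ (μ : Measure ℝ) (z : ℕ → ℝ) : Prop :=
  z 0 = 0 ∧ (∀ k : ℕ, 0 ≤ z (k+1)) ∧
  ∃ a b : ℕ → ℝ, IsJacobi μ a b ∧
    (∀ k : ℕ, b (k+1) = z (2*k) + z (2*k+1)) ∧
    (∀ k : ℕ, (a (k+1))^2 = z (2*k+1) * z (2*k+2))

def Gfun (x : ℝ) : ℝ := x - 1 - Real.log x

/-- The semicircle law. -/
def SCm : Measure ℝ :=
  volume.withDensity fun x => ENNReal.ofReal (Real.sqrt (4 - x^2) / (2*π))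

/-- The arcsine law on `(-2,2)`. -/
def ArcsineM : Measure ℝ :=
  volume.withDensity fun x => ENNReal.ofReal (1 / (π * Real.sqrt (4 - x^2)))

/-- The measure with density `(2/(π|q-p|)) √((x-p)/(q-x))` between `p` and `q`. -/
def Dmeas (p q : ℝ) : Measure ℝ :=
  volume.withDensity fun x => ENNReal.ofReal (2/(π * |q - p|) * Real.sqrt ((x - p)/(q - x)))

/-- The point `e^{iθ}` on the unit circle. -/
def ctheta (θ : ℝ) : ℂ := Complex.exp (θ * Complex.I)

/-- Reversed polynomial `Φ*` with conjugated coefficients: `Φ*(z) = z^k conj(Φ(1/conj z))`. -/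
def polyStar (P : Polynomial ℂ) : Polynomial ℂ := (P.map (starRingEnd ℂ)).reverse

/-- `α` is the sequence of Verblunsky coefficients of the measure `ν` on the unit circle
(`ν` being given in angle coordinates, carried by `[0, 2π)`): the monic orthogonal
polynomials of `ν` satisfy the Szegő recursion with coefficients `α`. -/
def IsVerblunsky (ν : Measure ℝ) (α : ℕ → ℂ) : Prop :=
  (∀ k, ‖α k‖ < 1) ∧
  ∃ Φ : ℕ → Polynomial ℂ,
    (∀ k, (Φ k).Monic) ∧ (∀ k, (Φ k).natDegree = k) ∧
    (∀ j k, j ≠ k →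
      ∫ θ, conj ((Φ j).eval (ctheta θ)) * (Φ k).eval (ctheta θ) ∂ν = 0) ∧
    (∀ k, Φ (k+1) = Polynomial.X * Φ k - Polynomial.C (conj (α k)) * polyStar (Φ k))

/-- `γ` is the sequence of deformed Verblunsky coefficients of `ν`. -/
def IsDeformedVerblunsky (ν : Measure ℝ) (γ : ℕ → ℂ) : Prop :=
  ∃ α : ℕ → ℂ, IsVerblunsky ν α ∧
    ∀ k : ℕ, γ k = conj (α k) * ∏ j ∈ Finset.range k, (1 - conj (γ j)) / (1 - γ j)

/-- Symmetry of a measure on the circle (in angle coordinates): invariance under conjugation. -/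
def SymmCircle (ν : Measure ℝ) : Prop :=
  (ν.map ctheta).map (starRingEnd ℂ) = ν.map ctheta

/-- The uniform measure on the circle, in angle coordinates. -/
def UNIFm : Measure ℝ :=
  volume.withDensity fun θ => ENNReal.ofReal (if 0 ≤ θ ∧ θ < 2*π then 1/(2*π) else 0)

end SumRules

namespace SumRules

/-- Outlier contribution for the Killip–Simon sum rule (`+∞` inside `(-2,2)`). -/
def FSC (x : ℝ) : ℝ≥0∞ :=
  if 2 ≤ |x| then
    ENNReal.ofReal (|x|/2 * Real.sqrt (x^2 - 4) - 2 * Real.log ((|x| + Real.sqrt (x^2 - 4))/2))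
  else ⊤

/-- Coefficient side of the Killip–Simon sum rule. -/
def IH (a b : ℕ → ℝ) : ℝ≥0∞ :=
  (1/2 : ℝ≥0∞) * ∑' k : ℕ, ENNReal.ofReal ((b (k+1))^2)
    + ∑' k : ℕ, ENNReal.ofReal (Gfun ((a (k+1))^2))

def tauM (τ : ℝ) : ℝ := (1 - Real.sqrt τ)^2
def tauP (τ : ℝ) : ℝ := (1 + Real.sqrt τ)^2

/-- The Marchenko–Pastur law with parameter `τ`. -/
def MPm (τ : ℝ) : Measure ℝ :=
  volume.withDensity fun x =>
    ENNReal.ofReal (Real.sqrt ((x - tauM τ) * (tauP τ - x)) / (2*π*τ*x))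

/-- Outlier contribution for the Marchenko–Pastur sum rule. -/
def FMP (τ : ℝ) (x : ℝ) : ℝ≥0∞ :=
  if tauP τ ≤ x then
    ENNReal.ofReal (∫ t in (tauP τ)..x, Real.sqrt ((t - tauP τ) * (t - tauM τ)) / (τ*t))
  else if 0 < x ∧ x ≤ tauM τ then
    ENNReal.ofReal (∫ t in x..(tauM τ), Real.sqrt ((t - tauP τ) * (t - tauM τ)) / (τ*t))
  else ⊤

/-- Coefficient side of the Marchenko–Pastur sum rule. -/
def IL (τ : ℝ) (z : ℕ → ℝ) : ℝ≥0∞ :=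
  ∑' k : ℕ, ENNReal.ofReal (τ⁻¹ * Gfun (z (2*k+1)) + Gfun (τ⁻¹ * z (2*k+2)))

def uPl (κ₁ κ₂ : ℝ) : ℝ :=
  2*(κ₂^2 - κ₁^2 + 4*Real.sqrt ((1+κ₁)*(1+κ₂)*(1+κ₁+κ₂)))/(2+κ₁+κ₂)^2
def uMi (κ₁ κ₂ : ℝ) : ℝ :=
  2*(κ₂^2 - κ₁^2 - 4*Real.sqrt ((1+κ₁)*(1+κ₂)*(1+κ₁+κ₂)))/(2+κ₁+κ₂)^2

/-- The Kesten–McKay law with parameters `κ₁, κ₂`. -/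
def KMKm (κ₁ κ₂ : ℝ) : Measure ℝ :=
  volume.withDensity fun x =>
    ENNReal.ofReal ((2+κ₁+κ₂)/(2*π) * Real.sqrt ((x - uMi κ₁ κ₂) * (uPl κ₁ κ₂ - x)) / (4 - x^2))

def ue (κ₁ κ₂ : ℝ) : ℝ := -(κ₁+κ₂)/(2+κ₁+κ₂)
def uo (κ₁ κ₂ : ℝ) : ℝ := (κ₂-κ₁)/(2+κ₁+κ₂)

def He (κ₁ κ₂ u : ℝ) : ℝ :=
  -(1+κ₁+κ₂) * Real.log ((1-u)/(1 - ue κ₁ κ₂)) - Real.log ((1+u)/(1 + ue κ₁ κ₂))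
def Ho (κ₁ κ₂ u : ℝ) : ℝ :=
  -(1+κ₁) * Real.log ((1-u)/(1 - uo κ₁ κ₂)) - (1+κ₂) * Real.log ((1+u)/(1 + uo κ₁ κ₂))

/-- Coefficient side of the Kesten–McKay sum rule. -/
def IJ (κ₁ κ₂ : ℝ) (u : ℕ → ℝ) : ℝ≥0∞ :=
  ∑' k : ℕ, (ENNReal.ofReal (Ho κ₁ κ₂ (u (2*k+1))) + ENNReal.ofReal (He κ₁ κ₂ (u (2*k+2))))

/-- Outlier contribution for the Kesten–McKay sum rule. -/
def FKMK (κ₁ κ₂ : ℝ) (x : ℝ) : ℝ≥0∞ :=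
  if uPl κ₁ κ₂ ≤ x then
    ENNReal.ofReal (∫ t in (uPl κ₁ κ₂)..x,
      (2+κ₁+κ₂) * Real.sqrt ((t - uPl κ₁ κ₂) * (t - uMi κ₁ κ₂)) / (4 - t^2))
  else if x ≤ uMi κ₁ κ₂ then
    ENNReal.ofReal (∫ t in x..(uMi κ₁ κ₂),
      (2+κ₁+κ₂) * Real.sqrt ((t - uPl κ₁ κ₂) * (t - uMi κ₁ κ₂)) / (4 - t^2))
  else ⊤

def Hgw (g : ℝ) : ℝ := 1 - Real.sqrt (1 - g^2) + Real.log ((1 + Real.sqrt (1 - g^2))/2)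

def thetaG (g : ℝ) : ℝ := 2 * Real.arcsin (Real.sqrt (1/|g|))

/-- The Gross–Witten measures, in angle coordinates. -/
def GWm (g : ℝ) : Measure ℝ :=
  if |g| ≤ 1 then
    volume.withDensity fun θ =>
      ENNReal.ofReal (if 0 ≤ θ ∧ θ < 2*π then (1 + g * Real.cos θ)/(2*π) else 0)
  else if g < -1 then
    volume.withDensity fun θ => ENNReal.ofReal (
      if π - thetaG g ≤ θ ∧ θ ≤ π + thetaG g then
        |g| / π * Real.sin (θ/2) * Real.sqrt (Real.sin (θ/2)^2 - Real.cos (thetaG g/2)^2)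
      else 0)
  else
    volume.withDensity fun θ => ENNReal.ofReal (
      if -thetaG g ≤ θ ∧ θ ≤ thetaG g then
        g/π * Real.cos (θ/2) * Real.sqrt (Real.sin (thetaG g/2)^2 - Real.sin (θ/2)^2)
      else 0)

def thetaD (d : ℝ) : ℝ := 2 * Real.arcsin (d/(1+d))
def gammaD (d : ℝ) : ℝ := -d/(1+d)

/-- The Hua–Pickrell measure, in angle coordinates. -/
def HPm (d : ℝ) : Measure ℝ :=
  volume.withDensity fun θ => ENNReal.ofReal (
    if thetaD d < θ ∧ θ < 2*π - thetaD d then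
      (1+d) * Real.sqrt (Real.sin (θ/2)^2 - Real.sin (thetaD d/2)^2) / (2*π*Real.sin (θ/2))
    else 0)

/-- The entropy-like function appearing in the Hua–Pickrell sum rule. -/
def HHP (d : ℝ) (γ : ℂ) : ℝ :=
  -Real.log ((1 - ‖γ‖^2)/(1 - (gammaD d)^2)) - 2*d*Real.log (‖1 - γ‖/(1 - gammaD d))

/-- Outlier contribution for the Hua–Pickrell sum rule (in angle coordinates). -/
def FHP (d : ℝ) (θ : ℝ) : ℝ≥0∞ :=
  if θ ≤ thetaD d then
    ENNReal.ofReal (∫ φ in θ..(thetaD d),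
      (1+d) * Real.sqrt (Real.sin (thetaD d/2)^2 - Real.sin (φ/2)^2) / Real.sin (φ/2))
  else if 2*π - thetaD d ≤ θ then
    ENNReal.ofReal (∫ φ in (2*π - thetaD d)..θ,
      (1+d) * Real.sqrt (Real.sin (thetaD d/2)^2 - Real.sin (φ/2)^2) / Real.sin (φ/2))
  else ⊤

/-- Set of outlying support points for a measure on the circle, in angle coordinates. -/
def EST (ν : Measure ℝ) (tm tp : ℝ) : Set ℝ := suppSet ν \ Icc tm tp

/-- `ν ∈ 𝒮₁^𝕋(tm, tp)` (in angle coordinates). -/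
def InS1T (ν : Measure ℝ) (tm tp : ℝ) : Prop := (EST ν tm tp).Countable

/-- The measure `𝒟(2,-2)`, with density `(1/2π)√((2-x)/(2+x))` on `(-2,2)`
(a shift of the hard-edge Marchenko–Pastur law). -/
def Dhard : Measure ℝ :=
  volume.withDensity fun x => ENNReal.ofReal (Real.sqrt ((2 - x)/(2 + x)) / (2*π))

/-- The mixture `μ_g = |g| 𝒟(2,-2) + (1-|g|) Arcsine`. -/
def mugMix (g : ℝ) : Measure ℝ :=
  ENNReal.ofReal |g| • Dhard + ENNReal.ofReal (1 - |g|) • ArcsineM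

/-- The mixture `ρ_g = |g| SC + (1-|g|) Arcsine`. -/
def rhog (g : ℝ) : Measure ℝ :=
  ENNReal.ofReal |g| • SCm + ENNReal.ofReal (1 - |g|) • ArcsineM

def Cg (g : ℝ) : ℝ :=
  -|g| * (1 - Real.log 2) + 1 - Real.sqrt (1 - g^2) + Real.log ((1 + Real.sqrt (1 - g^2))/2)

/-- The measure with density `(1/2π)(2+x)^{3/2}(2-x)^{1/2}` on `[-2,2]`. -/
def muHat : Measure ℝ :=
  volume.withDensity fun x =>
    ENNReal.ofReal ((2 + x) * Real.sqrt (2 + x) * Real.sqrt (2 - x) / (2*π))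

/-- The Poisson kernel measure `Pois(ζ)`, in angle coordinates. -/
def PoisM (ζ : ℂ) : Measure ℝ :=
  volume.withDensity fun θ => ENNReal.ofReal (
    if 0 ≤ θ ∧ θ < 2*π then (1 - ‖ζ‖^2)/(2*π*‖ctheta θ - ζ‖^2) else 0)

/-- The Carathéodory function of a measure on the circle (angle coordinates). -/
def Cara (ν : Measure ℝ) (z : ℂ) : ℂ := ∫ θ, (ctheta θ + z)/(ctheta θ - z) ∂ν

/-- `f` is the Schur function of `ν`. -/
def IsSchurFn (ν : Measure ℝ) (f : ℂ → ℂ) : Prop :=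
  DifferentiableOn ℂ f (Metric.ball 0 1) ∧
  (∀ z ∈ Metric.ball (0:ℂ) 1, ‖f z‖ ≤ 1) ∧
  (∀ z ∈ Metric.ball (0:ℂ) 1, Cara ν z - 1 = z * f z * (Cara ν z + 1))

/-- Möbius transform of the unit disk. -/
def mtrans (ρ z : ℂ) : ℂ := (z - ρ)/(1 - conj ρ * z)

def npRaw (ρ : ℂ) (g : ℂ → ℂ) (z : ℂ) : ℂ :=
  ((-ρ/(‖ρ‖ : ℂ)) / mtrans ρ z) * ((g z - g ρ)/(1 - conj (g ρ) * g z))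

-- One step of the Nevanlinna–Pick algorithm at `ρ` (the removable singularity at `ρ`
-- is filled in by the limit).
open Classical in
def npStep (ρ : ℂ) (g : ℂ → ℂ) : ℂ → ℂ := fun z =>
  if z = ρ then limUnder (𝓝[≠] ρ) (npRaw ρ g) else npRaw ρ g z

def schurRaw (g : ℂ → ℂ) (z : ℂ) : ℂ := ((g z - g 0)/z)/(1 - conj (g 0) * g z)

-- One step of the classical Schur algorithm (the removable singularity at `0`
-- is filled in by the limit).
open Classical in
def schurStep (g : ℂ → ℂ) : ℂ → ℂ := fun z =>
  if z = 0 then limUnder (𝓝[≠] (0:ℂ)) (schurRaw g) else schurRaw g z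

def xdHP (d : ℝ) : ℝ := 2*(1 + 2*d - d^2)/(1+d)^2

def uKMK (d : ℝ) : ℝ := 2*Real.sqrt (1 + 2*d)/(1+d)

end SumRules


namespace SumRules

def Sch (g : ℂ → ℂ) : Prop :=
  DifferentiableOn ℂ g (Metric.ball 0 1) ∧ ∀ z ∈ Metric.ball (0:ℂ) 1, ‖g z‖ ≤ 1

def Str (g : ℂ → ℂ) : Prop :=
  DifferentiableOn ℂ g (Metric.ball 0 1) ∧ ∀ z ∈ Metric.ball (0:ℂ) 1, ‖g z‖ < 1

lemma zero_mem_b : (0:ℂ) ∈ Metric.ball (0:ℂ) 1 := by simp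

lemma one_sub_ne {a b : ℂ} (ha : ‖a‖ < 1) (hb : ‖b‖ ≤ 1) : 1 - a * b ≠ 0 := by
  intro h
  have h1 : a * b = 1 := by linear_combination -h
  have h2 : ‖a‖ * ‖b‖ = 1 := by rw [← norm_mul, h1, norm_one]
  nlinarith [norm_nonneg a, norm_nonneg b]

lemma one_add_ne {a b : ℂ} (ha : ‖a‖ < 1) (hb : ‖b‖ ≤ 1) : 1 + a * b ≠ 0 := by
  have := one_sub_ne (a := -a) (b := b) (by simpa using ha) hb
  intro h; apply this; linear_combination h

lemma Sch.str {g : ℂ → ℂ} (hg : Sch g) (h0 : ‖g 0‖ < 1) : Str g := by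
  refine ⟨hg.1, fun z hz => lt_of_le_of_ne (hg.2 z hz) fun h => ?_⟩
  have hc := Complex.norm_eqOn_of_isPreconnected_of_isMaxOn (f := g) (U := Metric.ball (0:ℂ) 1)
    (c := z) (convex_ball _ _).isPreconnected Metric.isOpen_ball hg.1 hz
    (fun w hw => by simpa [h] using hg.2 w hw)
  have := hc zero_mem_b
  simp only [Function.comp, Function.const_apply] at this
  linarith

/-- key identity for the Moebius map -/
lemma moeb_id (a b : ℂ) : ‖1 - conj a * b‖^2 - ‖b - a‖^2 = (1 - ‖a‖^2) * (1 - ‖b‖^2) := by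
  simp only [← Complex.normSq_eq_norm_sq, Complex.normSq_apply]
  simp
  ring

lemma step_props {g : ℂ → ℂ} (hg : Str g) :
    Sch (schurStep g) ∧ ∀ z ∈ Metric.ball (0:ℂ) 1,
      g z * (1 + conj (g 0) * (z * schurStep g z)) = g 0 + z * schurStep g z := by
  have hγ : ‖conj (g 0)‖ < 1 := by simpa using hg.2 0 zero_mem_b
  have hγ' : ‖g 0‖ < 1 := by simpa using hg.2 0 zero_mem_b
  set T : ℂ → ℂ := fun z => (g z - g 0) / (1 - conj (g 0) * g z) with hT
  have hne : ∀ z ∈ Metric.ball (0:ℂ) 1, 1 - conj (g 0) * g z ≠ 0 := fun z hz =>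
    one_sub_ne hγ (hg.2 z hz).le
  have hTd : DifferentiableOn ℂ T (Metric.ball 0 1) := by
    apply DifferentiableOn.div _ _ hne
    · exact hg.1.sub (differentiableOn_const _)
    · exact (differentiableOn_const _).sub ((differentiableOn_const _).mul hg.1)
  have hT0 : T 0 = 0 := by simp [hT]
  have hTn : ∀ z ∈ Metric.ball (0:ℂ) 1, ‖T z‖ ≤ 1 := by
    intro z hz
    rw [hT]; simp only [norm_div]
    rw [div_le_one (norm_pos_iff.2 (hne z hz))]
    have h1 := moeb_id (g 0) (g z)
    have h2 := hg.2 z hz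
    rw [← pow_le_pow_iff_left₀ (norm_nonneg _) (norm_nonneg _) two_ne_zero]
    have : 0 ≤ (1 - ‖g 0‖^2) * (1 - ‖g z‖^2) := by
      apply mul_nonneg <;> nlinarith [norm_nonneg (g 0), norm_nonneg (g z)]
    linarith
  have hraw : ∀ z : ℂ, z ≠ 0 → schurRaw g z = dslope T 0 z := by
    intro z hz
    rw [dslope_of_ne _ hz, slope_def_field, hT0]
    simp only [schurRaw, hT, sub_zero]
    rw [div_right_comm]
  have hds : DifferentiableOn ℂ (dslope T 0) (Metric.ball 0 1) :=
    (Complex.differentiableOn_dslope (Metric.isOpen_ball.mem_nhds zero_mem_b)).2 hTd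
  have hlim : limUnder (𝓝[≠] (0:ℂ)) (schurRaw g) = dslope T 0 0 := by
    apply Tendsto.limUnder_eq
    have h1 : ContinuousAt (dslope T 0) 0 :=
      (hds.differentiableAt (Metric.isOpen_ball.mem_nhds zero_mem_b)).continuousAt
    refine (h1.tendsto.mono_left nhdsWithin_le_nhds).congr' ?_
    filter_upwards [self_mem_nhdsWithin] with z hz
    exact (hraw z hz).symm
  have heq : schurStep g = dslope T 0 := by
    ext z
    unfold schurStep
    split_ifs with h
    · rw [h, hlim]
    · exact hraw z h
  rw [heq]
  refine ⟨⟨hds, fun z hz => ?_⟩, fun z hz => ?_⟩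
  · have := Complex.norm_dslope_le_div_of_mapsTo_ball (f := T) (c := 0) (R₁ := 1) (R₂ := 1) hTd
      (fun w hw => by simpa [hT0] using hTn w hw) hz
    simpa using this
  · have h1 : z * dslope T 0 z = T z := by
      have := sub_smul_dslope T 0 z
      simpa [hT0] using this
    rw [h1]
    have h2 := hne z hz
    have h3 : T z * (1 - conj (g 0) * g z) = g z - g 0 := div_mul_cancel₀ _ h2
    linear_combination -h3

/-- numerator and denominator of the approximants -/
def ND : ℕ → (ℂ → ℂ) → ℂ → ℂ[X] × ℂ[X]
  | 0, _, c => (C c, 1)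
  | n+1, g, c =>
    (C (g 0) * (ND n (schurStep g) c).2 + X * (ND n (schurStep g) c).1,
     (ND n (schurStep g) c).2 + C (conj (g 0)) * (X * (ND n (schurStep g) c).1))

/-- product of `1 - |γ_j|²` -/
def kap : ℕ → (ℂ → ℂ) → ℝ
  | 0, _ => 1
  | n+1, g => (1 - ‖g 0‖^2) * kap n (schurStep g)

def AllStr : ℕ → (ℂ → ℂ) → Prop
  | 0, _ => True
  | n+1, g => Str g ∧ AllStr n (schurStep g)

lemma kap_pos : ∀ (n : ℕ) (g : ℂ → ℂ), AllStr n g → 0 < kap n g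
  | 0, g, _ => by simp [kap]
  | n+1, g, h => by
    have := h.1.2 0 zero_mem_b
    have h2 := kap_pos n _ h.2
    have : 0 < 1 - ‖g 0‖^2 := by nlinarith [norm_nonneg (g 0)]
    simp only [kap]; positivity

lemma ND_deg : ∀ (n : ℕ) (g : ℂ → ℂ) (c : ℂ),
    (ND n g c).1.natDegree ≤ n ∧ (ND n g c).2.natDegree ≤ n
  | 0, g, c => by simp [ND]
  | n+1, g, c => by
    obtain ⟨h1, h2⟩ := ND_deg n (schurStep g) c
    have h3 : (X * (ND n (schurStep g) c).1).natDegree ≤ n + 1 := by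
      refine natDegree_mul_le.trans ?_
      have := natDegree_X_le (R := ℂ); omega
    simp only [ND]
    constructor
    · refine (natDegree_add_le _ _).trans (max_le ?_ h3)
      exact (natDegree_C_mul_le _ _).trans (by omega)
    · refine (natDegree_add_le _ _).trans (max_le (by omega) ?_)
      exact (natDegree_C_mul_le _ _).trans h3

lemma ND_zero : ∀ (n : ℕ) (g : ℂ → ℂ) (c : ℂ), (ND n g c).2.eval 0 = 1
  | 0, g, c => by simp [ND]
  | n+1, g, c => by simp [ND, ND_zero n]

lemma ND_cont : ∀ (n : ℕ) (g : ℂ → ℂ) (i : ℕ),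
    Continuous (fun c => (ND n g c).1.coeff i) ∧ Continuous (fun c => (ND n g c).2.coeff i)
  | 0, g, i => by
    simp only [ND, coeff_C, coeff_one]
    constructor
    · split_ifs <;> fun_prop
    · fun_prop
  | n+1, g, i => by
    have hX : Continuous (fun c => (X * (ND n (schurStep g) c).1).coeff i) := by
      cases i with
      | zero => simp only [mul_coeff_zero, coeff_X_zero, zero_mul]; fun_prop
      | succ i => simp only [coeff_X_mul]; exact (ND_cont n _ i).1
    have h2 := (ND_cont n (schurStep g) i).2
    simp only [ND, coeff_add, coeff_C_mul]
    constructor <;> fun_prop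

lemma quad_id (γ a b : ℂ) :
    ‖b + conj γ * a‖^2 - ‖γ * b + a‖^2 = (1 - ‖γ‖^2) * (‖b‖^2 - ‖a‖^2) := by
  simp only [← Complex.normSq_eq_norm_sq, Complex.normSq_apply]
  simp
  ring

lemma ND_norm_id (n : ℕ) (g : ℂ → ℂ) (c z : ℂ) :
    ‖(ND (n+1) g c).2.eval z‖^2 - ‖(ND (n+1) g c).1.eval z‖^2 =
    (1 - ‖g 0‖^2) * (‖(ND n (schurStep g) c).2.eval z‖^2
      - ‖z‖^2 * ‖(ND n (schurStep g) c).1.eval z‖^2) := by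
  have := quad_id (g 0) (z * (ND n (schurStep g) c).1.eval z) ((ND n (schurStep g) c).2.eval z)
  rw [norm_mul, mul_pow] at this
  rw [← this]
  simp [ND]

lemma ND_circle : ∀ (n : ℕ) (g : ℂ → ℂ) (c z : ℂ), ‖z‖ = 1 →
    ‖(ND n g c).2.eval z‖^2 - ‖(ND n g c).1.eval z‖^2 = kap n g * (1 - ‖c‖^2)
  | 0, g, c, z, hz => by simp [ND, kap]
  | n+1, g, c, z, hz => by
    rw [ND_norm_id, hz, one_pow, one_mul, ND_circle n _ c z hz, kap]; ring

lemma ND_lt : ∀ (n : ℕ) (g : ℂ → ℂ) (c z : ℂ), AllStr n g → ‖c‖ < 1 → ‖z‖ ≤ 1 →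
    ‖(ND n g c).1.eval z‖ < ‖(ND n g c).2.eval z‖
  | 0, g, c, z, _, hc, hz => by simpa [ND] using hc
  | n+1, g, c, z, hs, hc, hz => by
    have h1 := ND_norm_id n g c z
    have h2 := ND_lt n (schurStep g) c z hs.2 hc hz
    have h3 := hs.1.2 0 zero_mem_b
    set a := ‖(ND n (schurStep g) c).1.eval z‖ with ha
    set b := ‖(ND n (schurStep g) c).2.eval z‖ with hb
    have ha0 : 0 ≤ a := norm_nonneg _
    have h4 : 0 < 1 - ‖g 0‖^2 := by nlinarith [norm_nonneg (g 0)]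
    have h5 : ‖z‖^2 * a^2 ≤ a^2 := by
      have : ‖z‖^2 ≤ 1 := by nlinarith [norm_nonneg z]
      nlinarith [sq_nonneg a]
    have h6 : 0 < (1 - ‖g 0‖^2) * (b^2 - ‖z‖^2 * a^2) := by
      apply mul_pos h4; nlinarith
    apply lt_of_pow_lt_pow_left₀ 2 (norm_nonneg _)
    linarith

/-- matching -/
lemma ND_match : ∀ (n : ℕ) (g : ℂ → ℂ), AllStr n g → Sch g →
    ∃ E : ℂ → ℂ, ContinuousOn E (Metric.ball 0 1) ∧ (∀ z ∈ Metric.ball (0:ℂ) 1, E z ≠ 0) ∧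
      ContinuousOn (schurStep^[n] g) (Metric.ball 0 1) ∧ ∀ c : ℂ,
      ∀ z ∈ Metric.ball (0:ℂ) 1,
        E z * ((ND n g c).2.eval z * g z - (ND n g c).1.eval z)
          = z^n * (kap n g * ((schurStep^[n] g) z - c))
  | 0, g, _, hg => by
    refine ⟨fun _ => 1, continuousOn_const, fun _ _ => one_ne_zero, ?_, ?_⟩
    · simpa using hg.1.continuousOn
    · intro c z hz; simp [ND, kap]
  | n+1, g, hs, hg => by
    obtain ⟨hsch, hid⟩ := step_props hs.1
    obtain ⟨E, hE, hE0, hc, hm⟩ := ND_match n (schurStep g) hs.2 hsch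
    refine ⟨fun z => E z * (1 + conj (g 0) * (z * schurStep g z)), ?_, ?_, ?_, ?_⟩
    · apply hE.mul
      apply continuousOn_const.add (continuousOn_const.mul (continuousOn_id.mul hsch.1.continuousOn))
    · intro z hz
      refine mul_ne_zero (hE0 z hz) (one_add_ne ?_ ?_)
      · simpa using hs.1.2 0 zero_mem_b
      · rw [norm_mul]
        have h1 := hsch.2 z hz
        have h2 : ‖z‖ < 1 := by simpa using hz
        nlinarith [norm_nonneg z, norm_nonneg (schurStep g z)]
    · simpa using hc
    · intro c z hz
      have h1 := hm c z hz
      have h2 := hid z hz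
      have h3 : conj (g 0) * g 0 = ((‖g 0‖^2 : ℝ) : ℂ) := by
        rw [Complex.conj_mul']; norm_cast
      simp only [ND, kap, Function.iterate_succ, Function.comp_apply, eval_add, eval_mul, eval_C,
        eval_X]
      push_cast at h3 ⊢
      set N := (ND n (schurStep g) c).1.eval z
      set D := (ND n (schurStep g) c).2.eval z
      linear_combination (z * (1 - (‖g 0‖:ℂ)^2)) * h1 + E z * (D + conj (g 0) * (z * N)) * h2
        + E z * (z * N - D * z * schurStep g z) * h3

/-- the general term of the sum -/
def tm (ζ : ℂ) (g : ℂ → ℂ) : ℝ := Real.log ((1 - ‖ζ * g ζ‖^2) / (1 - ‖g ζ‖^2))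

lemma ND_entropy (ζ : ℂ) (hζ : ‖ζ‖ < 1) : ∀ (n : ℕ) (g : ℂ → ℂ), AllStr n g →
    Sch g → ‖(schurStep^[n] g) ζ‖ < 1 →
    2 * Real.log ‖(ND n g ((schurStep^[n] g) ζ)).2.eval ζ‖
      - Real.log (kap n g * (1 - ‖(schurStep^[n] g) ζ‖^2))
    = - Real.log (1 - ‖g ζ‖^2) + ∑ k ∈ Finset.range n, tm ζ (schurStep^[k+1] g)
  | 0, g, _, hg, hn => by simp [ND, kap]
  | n+1, g, hs, hg, hn => by
    obtain ⟨hsch, hid⟩ := step_props hs.1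
    have hz : ζ ∈ Metric.ball (0:ℂ) 1 := by simpa using hζ
    have ih := ND_entropy ζ hζ n (schurStep g) hs.2 hsch (by simpa using hn)
    obtain ⟨E, hE, hE0, hc, hm⟩ := ND_match n (schurStep g) hs.2 hsch
    have hm1 := hm ((schurStep^[n] (schurStep g)) ζ) ζ hz
    simp only [sub_self, mul_zero, mul_eq_zero, hE0 ζ hz, false_or] at hm1
    simp only [Function.iterate_succ, Function.comp_apply] at hn ⊢
    set c := (schurStep^[n] (schurStep g)) ζ with hc
    have hg1 : ‖schurStep g ζ‖ < 1 := by
      cases n with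
      | zero => simpa [hc] using hn
      | succ n => exact hs.2.1.2 ζ hz
    have hD0 : (ND n (schurStep g) c).2.eval ζ ≠ 0 := by
      have := ND_lt n (schurStep g) c ζ hs.2 hn hζ.le
      intro h; rw [h, norm_zero] at this
      exact absurd this (not_lt.2 (norm_nonneg _))
    have hγ := hs.1.2 0 zero_mem_b
    have hne : 1 + conj (g 0) * (ζ * schurStep g ζ) ≠ 0 := by
      refine one_add_ne (by simpa using hγ) ?_
      rw [norm_mul]; nlinarith [norm_nonneg ζ, norm_nonneg (schurStep g ζ)]
    have hDD : (ND (n+1) g c).2.eval ζ = (ND n (schurStep g) c).2.eval ζ *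
        (1 + conj (g 0) * (ζ * schurStep g ζ)) := by
      simp only [ND, eval_add, eval_mul, eval_C, eval_X]
      linear_combination (-conj (g 0) * ζ) * hm1
    have hk := kap_pos n _ hs.2
    have hgp : 0 < 1 - ‖g 0‖^2 := by nlinarith [norm_nonneg (g 0)]
    have hcp : 0 < 1 - ‖c‖^2 := by nlinarith [norm_nonneg c]
    have hg1p : 0 < 1 - ‖schurStep g ζ‖^2 := by nlinarith [norm_nonneg (schurStep g ζ)]
    have hg2 : ‖ζ * schurStep g ζ‖ < 1 := by
      rw [norm_mul]; nlinarith [norm_nonneg ζ, norm_nonneg (schurStep g ζ)]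
    have hg2p : 0 < 1 - ‖ζ * schurStep g ζ‖^2 := by nlinarith [norm_nonneg (ζ * schurStep g ζ)]
    have hgz := hs.1.2 ζ hz
    have hgzp : 0 < 1 - ‖g ζ‖^2 := by nlinarith [norm_nonneg (g ζ)]
    have key : (1 - ‖g ζ‖^2) * ‖1 + conj (g 0) * (ζ * schurStep g ζ)‖^2
        = (1 - ‖g 0‖^2) * (1 - ‖ζ * schurStep g ζ‖^2) := by
      have h1 := quad_id (g 0) (ζ * schurStep g ζ) 1
      have h2 := hid ζ hz
      rw [mul_one, ← h2, norm_mul, mul_pow, norm_one] at h1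
      linarith
    have hlk := congrArg Real.log key
    have hnn : ‖1 + conj (g 0) * (ζ * schurStep g ζ)‖ ≠ 0 := norm_ne_zero_iff.2 hne
    rw [Real.log_mul hgzp.ne' (by positivity), Real.log_mul hgp.ne' hg2p.ne', Real.log_pow] at hlk
    rw [hDD, norm_mul, Real.log_mul (norm_ne_zero_iff.2 hD0) hnn, kap, mul_assoc,
      Real.log_mul hgp.ne' (by positivity), Finset.sum_range_succ']
    have htm : tm ζ (schurStep g) = Real.log (1 - ‖ζ * schurStep g ζ‖^2)
        - Real.log (1 - ‖schurStep g ζ‖^2) := by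
      rw [tm, Real.log_div hg2p.ne' hg1p.ne']
    simp only [Function.iterate_succ, Function.comp_apply, Function.iterate_zero, id] at ih ⊢
    rw [htm]
    push_cast at hlk
    linarith

abbrev Sph : Set ℂ := Metric.sphere (0:ℂ) 1

lemma ctheta_norm (θ : ℝ) : ‖ctheta θ‖ = 1 := by
  simp [ctheta, Complex.norm_exp_ofReal_mul_I]

lemma ctheta_mem (θ : ℝ) : ctheta θ ∈ Sph := by simp [ctheta_norm]

lemma ctheta_cont : Continuous ctheta := by unfold ctheta; fun_prop

lemma intg {E : Type*} [NormedAddCommGroup E] {φ : ℂ → E} (hφ : ContinuousOn φ Sph)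
    (μ : Measure ℝ) [IsFiniteMeasure μ] :
    Continuous (fun θ => φ (ctheta θ)) ∧ ∃ M, ∀ θ, ‖φ (ctheta θ)‖ ≤ M := by
  refine ⟨hφ.comp_continuous ctheta_cont ctheta_mem, ?_⟩
  obtain ⟨M, hM⟩ := (isCompact_sphere (0:ℂ) 1).exists_bound_of_continuousOn hφ
  exact ⟨M, fun θ => hM _ (ctheta_mem θ)⟩

lemma intg' {E : Type*} [NormedAddCommGroup E] [SecondCountableTopology E] {φ : ℂ → E}
    (hφ : ContinuousOn φ Sph)
    (μ : Measure ℝ) [IsFiniteMeasure μ] : Integrable (fun θ => φ (ctheta θ)) μ := by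
  obtain ⟨h, M, hM⟩ := intg hφ μ
  exact Integrable.of_bound h.aestronglyMeasurable M (Eventually.of_forall hM)

def Lf (μ₁ μ₂ : Measure ℝ) (φ : ℂ → ℂ) : ℂ :=
  ∫ θ, φ (ctheta θ) ∂μ₁ - ∫ θ, φ (ctheta θ) ∂μ₂

section Lf
variable (μ₁ μ₂ : Measure ℝ) [IsFiniteMeasure μ₁] [IsFiniteMeasure μ₂]

lemma Lf_congr {φ ψ : ℂ → ℂ} (h : ∀ z, ‖z‖ = 1 → φ z = ψ z) : Lf μ₁ μ₂ φ = Lf μ₁ μ₂ ψ := by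
  unfold Lf; simp only [h _ (ctheta_norm _)]

lemma Lf_add {φ ψ : ℂ → ℂ} (h : ContinuousOn φ Sph) (h' : ContinuousOn ψ Sph) :
    Lf μ₁ μ₂ (fun z => φ z + ψ z) = Lf μ₁ μ₂ φ + Lf μ₁ μ₂ ψ := by
  unfold Lf
  rw [integral_add (intg' h _) (intg' h' _), integral_add (intg' h _) (intg' h' _)]; ring

lemma Lf_sub {φ ψ : ℂ → ℂ} (h : ContinuousOn φ Sph) (h' : ContinuousOn ψ Sph) :
    Lf μ₁ μ₂ (fun z => φ z - ψ z) = Lf μ₁ μ₂ φ - Lf μ₁ μ₂ ψ := by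
  unfold Lf
  rw [integral_sub (intg' h _) (intg' h' _), integral_sub (intg' h _) (intg' h' _)]; ring

lemma Lf_smul (a : ℂ) (φ : ℂ → ℂ) :
    Lf μ₁ μ₂ (fun z => a * φ z) = a * Lf μ₁ μ₂ φ := by
  unfold Lf
  rw [integral_const_mul, integral_const_mul]; ring

lemma Lf_sum {ι : Type*} (s : Finset ι) {φ : ι → ℂ → ℂ} (h : ∀ i ∈ s, ContinuousOn (φ i) Sph) :
    Lf μ₁ μ₂ (fun z => ∑ i ∈ s, φ i z) = ∑ i ∈ s, Lf μ₁ μ₂ (φ i) := by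
  unfold Lf
  rw [integral_finsetSum _ (fun i hi => intg' (h i hi) _),
    integral_finsetSum _ (fun i hi => intg' (h i hi) _), Finset.sum_sub_distrib]

lemma Lf_conj (φ : ℂ → ℂ) : Lf μ₁ μ₂ (fun z => conj (φ z)) = conj (Lf μ₁ μ₂ φ) := by
  unfold Lf
  rw [integral_conj, integral_conj, map_sub]

def Ck (w z : ℂ) : ℂ := (1 - w * conj z)⁻¹

lemma Ck_ne {w z : ℂ} (hw : ‖w‖ < 1) (hz : ‖z‖ = 1) : 1 - w * conj z ≠ 0 :=
  one_sub_ne hw (by simp [hz])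

lemma Ck_cont {w : ℂ} (hw : ‖w‖ < 1) : ContinuousOn (Ck w) Sph := by
  apply ContinuousOn.inv₀
  · fun_prop
  · intro z hz; exact Ck_ne hw (by simpa using hz)

lemma Ck_norm {w z : ℂ} {r : ℝ} (hr : r < 1) (hw : ‖w‖ ≤ r) (hz : ‖z‖ = 1) :
    ‖Ck w z‖ ≤ (1 - r)⁻¹ := by
  rw [Ck, norm_inv]
  apply inv_anti₀ (by linarith)
  have := norm_sub_norm_le (1:ℂ) (w * conj z)
  simp [hz] at this
  linarith

lemma int_Ck_cont (μ : Measure ℝ) [IsFiniteMeasure μ] (j : ℕ) :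
    ContinuousAt (fun w => ∫ θ, (conj (ctheta θ))^j * Ck w (ctheta θ) ∂μ) 0 := by
  have hev : ∀ᶠ w : ℂ in 𝓝 0, ‖w‖ < 1/2 := by
    have := Metric.ball_mem_nhds (0:ℂ) (show (0:ℝ) < 1/2 by norm_num)
    filter_upwards [this] with w hw; simpa using hw
  apply continuousAt_of_dominated (bound := fun _ => (1 - 1/2 : ℝ)⁻¹)
  · filter_upwards [hev] with w hw
    refine (intg' (φ := fun z => (conj z)^j * Ck w z) ?_ μ).aestronglyMeasurable
    exact ContinuousOn.mul (by fun_prop) (Ck_cont (by linarith))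
  · filter_upwards [hev] with w hw
    refine Eventually.of_forall fun θ => ?_
    rw [norm_mul]; simp only [norm_pow, RCLike.norm_conj, ctheta_norm, one_pow, one_mul]
    exact Ck_norm (by norm_num) hw.le (ctheta_norm θ)
  · exact integrable_const _
  · refine Eventually.of_forall fun θ => ?_
    apply ContinuousAt.mul continuousAt_const
    unfold Ck
    apply ContinuousAt.inv₀
    · fun_prop
    · simp

lemma conj_mul_one {z : ℂ} (hz : ‖z‖ = 1) : conj z * z = 1 := by
  rw [Complex.conj_mul', hz]; simp

lemma contOn_pow (j : ℕ) : ContinuousOn (fun z : ℂ => (conj z)^j) Sph := by fun_prop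

/-- backward shift lemma -/
lemma Lf_shift (m : ℕ) (U : ℂ → ℂ) (hU : ContinuousAt U 0)
    (h : ∀ w : ℂ, ‖w‖ < 1 → Lf μ₁ μ₂ (Ck w) = w^m * U w) :
    ∀ j ≤ m, ∀ w : ℂ, ‖w‖ < 1 → Lf μ₁ μ₂ (fun z => (conj z)^j * Ck w z) = w^(m-j) * U w := by
  intro j
  induction j with
  | zero => intro _ w hw; simpa using h w hw
  | succ j ih =>
    intro hj w hw
    have h0 : Lf μ₁ μ₂ (fun z => (conj z)^j) = 0 := by
      have := ih (by omega) 0 (by simp)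
      rw [zero_pow (by omega), zero_mul] at this
      rw [← this]
      apply Lf_congr; intro z hz; simp [Ck]
    have hmain : ∀ w : ℂ, ‖w‖ < 1 → w ≠ 0 →
        Lf μ₁ μ₂ (fun z => (conj z)^(j+1) * Ck w z) = w^(m-(j+1)) * U w := by
      intro w hw hw0
      have h1 : w * Lf μ₁ μ₂ (fun z => (conj z)^(j+1) * Ck w z) = w^(m-j) * U w := by
        rw [← ih (by omega) w hw, ← Lf_smul]
        have h2 := Lf_sub μ₁ μ₂ (φ := fun z => (conj z)^j * Ck w z) (ψ := fun z => (conj z)^j)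
          ((contOn_pow j).mul (Ck_cont hw)) (contOn_pow j)
        rw [h0, sub_zero] at h2
        rw [← h2]
        apply Lf_congr
        intro z hz
        have := Ck_ne hw hz
        rw [Ck]; field_simp; ring
      have h3 : m - j = (m - (j+1)) + 1 := by omega
      rw [h3, pow_succ'] at h1
      apply mul_left_cancel₀ hw0; rw [h1]; ring
    by_cases hw0 : w = 0
    · subst hw0
      have hc1 : ContinuousAt (fun w => Lf μ₁ μ₂ (fun z => (conj z)^(j+1) * Ck w z)) 0 :=
        (int_Ck_cont μ₁ (j+1)).sub (int_Ck_cont μ₂ (j+1))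
      have hc2 : ContinuousAt (fun w => w^(m-(j+1)) * U w) 0 := by fun_prop
      have e1 := hc1.tendsto.mono_left (nhdsWithin_le_nhds (s := {0}ᶜ))
      have e2 := hc2.tendsto.mono_left (nhdsWithin_le_nhds (s := {0}ᶜ))
      refine tendsto_nhds_unique e1 (e2.congr' ?_)
      have hb : Metric.ball (0:ℂ) 1 ∈ 𝓝[≠] (0:ℂ) :=
        nhdsWithin_le_nhds (Metric.ball_mem_nhds _ one_pos)
      filter_upwards [hb, self_mem_nhdsWithin] with w hw hw'
      exact (hmain w (by simpa using hw) hw').symm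
    · exact hmain w hw hw0

lemma Lf_pow (m : ℕ) (U : ℂ → ℂ) (hU : ContinuousAt U 0)
    (h : ∀ w : ℂ, ‖w‖ < 1 → Lf μ₁ μ₂ (Ck w) = w^m * U w) (j : ℕ) (hj : j ≤ m) :
    Lf μ₁ μ₂ (fun z => (conj z)^j) = 0^(m-j) * U 0 := by
  rw [← Lf_shift μ₁ μ₂ m U hU h j hj 0 (by simp)]
  apply Lf_congr; intro z hz; simp [Ck]

/-- Poisson kernel on the circle -/
lemma pk_eq {ζ z : ℂ} (hζ : ‖ζ‖ < 1) (hz : ‖z‖ = 1) :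
    ((poissonKernel 0 ζ z : ℝ) : ℂ) = Ck ζ z + conj (Ck ζ z) - 1 := by
  have h1 := Ck_ne hζ hz
  have hzz := conj_mul_one hz
  have h2 : 1 - conj ζ * z ≠ 0 := by
    have := (map_ne_zero (starRingEnd ℂ)).2 h1; simpa using this
  have h3 : ((‖z - ζ‖^2 : ℝ) : ℂ) = (1 - ζ * conj z) * (1 - conj ζ * z) := by
    push_cast
    rw [← Complex.mul_conj']
    simp only [map_sub]
    linear_combination (1 - conj ζ * ζ) * hzz
  have h4 : ((‖ζ‖^2 : ℝ) : ℂ) = ζ * conj ζ := by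
    push_cast; rw [← Complex.mul_conj']
  rw [poissonKernel_def]
  simp only [sub_zero, hz, Ck]
  rw [Complex.ofReal_div, h3, Complex.ofReal_sub, h4]
  simp only [map_inv₀, map_sub, map_mul, map_one, Complex.conj_conj]
  push_cast
  field_simp
  linear_combination (ζ * conj ζ) * hzz

lemma Lf_poisson (ζ : ℂ) (hζ : ‖ζ‖ < 1) (n : ℕ) (U : ℂ → ℂ) (hU : ContinuousAt U 0)
    (hU0 : U ζ = 0)
    (h : ∀ w : ℂ, ‖w‖ < 1 → Lf μ₁ μ₂ (Ck w) = w^(n+1) * U w) (j : ℕ) (hj : j ≤ n+1) :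
    Lf μ₁ μ₂ (fun z => (conj z)^j * (poissonKernel 0 ζ z : ℝ)) = 0 := by
  have he : ∀ j ≤ n+1, Lf μ₁ μ₂ (fun z => (conj z)^j * Ck ζ z) = 0 := by
    intro j hj; rw [Lf_shift μ₁ μ₂ (n+1) U hU h j hj ζ hζ, hU0, mul_zero]
  have hp : ∀ j ≤ n, Lf μ₁ μ₂ (fun z => (conj z)^j) = 0 := by
    intro j hj; rw [Lf_pow μ₁ μ₂ (n+1) U hU h j (by omega), zero_pow (by omega), zero_mul]
  have hcc : ContinuousOn (fun z => conj (Ck ζ z)) Sph :=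
    (RCLike.continuous_conj (K := ℂ)).comp_continuousOn (Ck_cont hζ)
  have hrec : ∀ z : ℂ, ‖z‖ = 1 → conj z * conj (Ck ζ z) = conj z + conj ζ * conj (Ck ζ z) := by
    intro z hz
    have h1 := (map_ne_zero (starRingEnd ℂ)).2 (Ck_ne hζ hz)
    have hzz := conj_mul_one hz
    have h1' : 1 - conj ζ * z ≠ 0 := by simpa using h1
    simp only [Ck, map_inv₀, map_sub, map_mul, map_one, Complex.conj_conj]
    field_simp
    linear_combination conj ζ * hzz
  have ha : ∀ j ≤ n, Lf μ₁ μ₂ (fun z => (conj z)^j * conj (Ck ζ z)) = 0 := by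
    intro j
    induction j with
    | zero =>
      intro _
      have := he 0 (by omega)
      simp only [pow_zero, one_mul] at this ⊢
      rw [Lf_conj, this, map_zero]
    | succ j ih =>
      intro hj
      have h1 := Lf_add μ₁ μ₂ (φ := fun z => (conj z)^(j+1))
        (ψ := fun z => conj ζ * ((conj z)^j * conj (Ck ζ z))) (contOn_pow _)
        (continuousOn_const.mul ((contOn_pow j).mul hcc))
      rw [hp (j+1) hj, Lf_smul, ih (by omega), mul_zero, zero_add] at h1
      rw [← h1]
      apply Lf_congr; intro z hz
      rw [pow_succ, mul_assoc, hrec z hz]; ring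
  cases j with
  | zero =>
    have h1 := Lf_add μ₁ μ₂ (Ck_cont hζ) hcc
    have h2 := Lf_sub μ₁ μ₂ (φ := fun z => Ck ζ z + conj (Ck ζ z)) ((Ck_cont hζ).add hcc)
      (contOn_pow 0)
    have e1 := he 0 (by omega)
    have e2 := ha 0 (by omega)
    have e3 := hp 0 (by omega)
    simp only [pow_zero, one_mul] at e1 e2 e3 h2 ⊢
    rw [e1, e2] at h1
    rw [e3, sub_zero] at h2
    rw [zero_add] at h1
    refine Eq.trans (Lf_congr _ _ fun z hz => ?_) (h2.trans h1)
    rw [pk_eq hζ hz]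
  | succ j =>
    have h1 := Lf_add μ₁ μ₂ (φ := fun z => (conj z)^(j+1) * Ck ζ z)
        (ψ := fun z => conj ζ * ((conj z)^j * conj (Ck ζ z))) ((contOn_pow _).mul (Ck_cont hζ))
        (continuousOn_const.mul ((contOn_pow j).mul hcc))
    rw [he (j+1) hj, Lf_smul, ha j (by omega), mul_zero, zero_add] at h1
    refine Eq.trans (Lf_congr _ _ fun z hz => ?_) h1
    rw [pk_eq hζ hz, pow_succ]
    linear_combination (conj z)^j * hrec z hz

lemma pow_red {z : ℂ} (hz : ‖z‖ = 1) (i j : ℕ) :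
    z^i * (conj z)^j = if i ≤ j then (conj z)^(j-i) else conj ((conj z)^(i-j)) := by
  have hzz := conj_mul_one hz
  split_ifs with h
  · obtain ⟨d, rfl⟩ := Nat.exists_eq_add_of_le h
    rw [Nat.add_sub_cancel_left, pow_add, ← mul_assoc, ← mul_pow, mul_comm z, hzz]; simp
  · obtain ⟨d, rfl⟩ := Nat.exists_eq_add_of_le (not_le.1 h).le
    rw [Nat.add_sub_cancel_left, pow_add, map_pow, Complex.conj_conj]
    have : z^j * (conj z)^j = 1 := by rw [← mul_pow, mul_comm z, hzz, one_pow]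
    linear_combination z^d * this

/-- the `(i,j)` moments with weight `p` are controlled -/
lemma Lf_pow_pow (p : ℂ → ℝ) (i j : ℕ) :
    Lf μ₁ μ₂ (fun z => z^i * (conj z)^j * (p z : ℂ)) =
      if i ≤ j then Lf μ₁ μ₂ (fun z => (conj z)^(j-i) * (p z : ℂ))
      else conj (Lf μ₁ μ₂ (fun z => (conj z)^(i-j) * (p z : ℂ))) := by
  split_ifs with h
  · apply Lf_congr; intro z hz; rw [pow_red hz, if_pos h]
  · rw [← Lf_conj]; apply Lf_congr; intro z hz; rw [pow_red hz, if_neg h]; simp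

lemma normSq_expand (Q : ℂ[X]) (m : ℕ) (hQ : Q.natDegree ≤ m) (z : ℂ) :
    ((‖Q.eval z‖^2 : ℝ) : ℂ) = ∑ i ∈ Finset.range (m+1), ∑ j ∈ Finset.range (m+1),
      (Q.coeff i * conj (Q.coeff j)) * (z^i * (conj z)^j) := by
  push_cast
  rw [← Complex.mul_conj', eval_eq_sum_range' (Nat.lt_succ_of_le hQ), map_sum,
    Finset.sum_mul_sum]
  refine Finset.sum_congr rfl fun i _ => Finset.sum_congr rfl fun j _ => ?_
  simp; ring

lemma Lf_normSq (p : ℂ → ℝ) (hp : ContinuousOn p Sph) (Q : ℂ[X]) (m : ℕ)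
    (hQ : Q.natDegree ≤ m) :
    Lf μ₁ μ₂ (fun z => ((‖Q.eval z‖^2 * p z : ℝ) : ℂ)) =
      ∑ i ∈ Finset.range (m+1), ∑ j ∈ Finset.range (m+1),
      (Q.coeff i * conj (Q.coeff j)) * Lf μ₁ μ₂ (fun z => z^i * (conj z)^j * (p z : ℂ)) := by
  have hp' : ContinuousOn (fun z => (p z : ℂ)) Sph :=
    Complex.continuous_ofReal.comp_continuousOn hp
  have h1 : ∀ i j : ℕ, ContinuousOn (fun z : ℂ => (Q.coeff i * conj (Q.coeff j)) *
      (z^i * (conj z)^j * (p z : ℂ))) Sph := fun i j => by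
    refine continuousOn_const.mul (ContinuousOn.mul ?_ hp'); fun_prop
  simp only [← Lf_smul]
  simp only [Complex.ofReal_mul, normSq_expand Q m hQ, Finset.sum_mul]
  rw [Lf_sum]
  · refine Finset.sum_congr rfl fun i _ => ?_
    rw [Lf_sum]
    · refine Finset.sum_congr rfl fun j _ => ?_
      apply Lf_congr; intro z _; ring
    · intro j _
      exact (h1 i j).congr fun z _ => by ring
  · intro i _
    apply continuousOn_finsetSum; intro j _
    exact (h1 i j).congr fun z _ => by ring

end Lf

def DM (p : ℂ → ℝ) : Measure ℝ :=
  volume.withDensity fun θ => ENNReal.ofReal (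
    if 0 ≤ θ ∧ θ < 2*π then p (ctheta θ) / (2*π) else 0)

def dmf (p : ℂ → ℝ) : ℝ → ℝ := (Ico 0 (2*π)).indicator (fun θ => p (ctheta θ) / (2*π))

lemma DM_eq (p : ℂ → ℝ) : DM p = volume.withDensity fun θ => ENNReal.ofReal (dmf p θ) := by
  unfold DM dmf
  congr 1
  ext θ
  simp only [Set.indicator_apply, Set.mem_Ico]

lemma PoisM_eq (ζ : ℂ) : PoisM ζ = DM (poissonKernel 0 ζ) := by
  unfold PoisM DM
  congr 1; ext θ
  congr 1
  split_ifs
  · rw [poissonKernel_def]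
    simp only [sub_zero, ctheta_norm, one_pow]
    rw [div_div, mul_comm (2*π)]
  · rfl

lemma circleMap_ctheta (θ : ℝ) : circleMap 0 1 θ = ctheta θ := by
  simp [circleMap, ctheta]

section DM
variable {p : ℂ → ℝ} (hp : ContinuousOn p Sph) (hp0 : ∀ z ∈ Sph, 0 ≤ p z)

lemma dmf_meas (hp : ContinuousOn p Sph) : Measurable (dmf p) := by
  unfold dmf
  refine Measurable.indicator ?_ measurableSet_Ico
  exact ((hp.comp_continuous ctheta_cont ctheta_mem).div_const _).measurable

lemma dmf_nonneg (hp0 : ∀ z ∈ Sph, 0 ≤ p z) (θ : ℝ) : 0 ≤ dmf p θ := by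
  unfold dmf
  apply Set.indicator_nonneg
  intro θ _
  exact div_nonneg (hp0 _ (ctheta_mem θ)) (by positivity)

lemma dmf_integrable (hp : ContinuousOn p Sph) : Integrable (dmf p) := by
  unfold dmf
  rw [integrable_indicator_iff measurableSet_Ico]
  have : IsFiniteMeasure (volume.restrict (Ico 0 (2*π))) := ⟨by simpa using ENNReal.mul_lt_top (by simp) (by simp)⟩
  exact (intg' hp _).div_const _

lemma DM_finite (hp : ContinuousOn p Sph) : IsFiniteMeasure (DM p) := by
  rw [DM_eq]
  exact isFiniteMeasure_withDensity_ofReal (dmf_integrable hp).2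

lemma DM_int {E : Type*} [NormedAddCommGroup E] [NormedSpace ℝ E]
    (hp : ContinuousOn p Sph) (hp0 : ∀ z ∈ Sph, 0 ≤ p z) (φ : ℂ → E) :
    ∫ θ, φ (ctheta θ) ∂(DM p) = Real.circleAverage (fun z => p z • φ z) 0 1 := by
  rw [DM_eq, integral_withDensity_eq_integral_toReal_smul
    (dmf_meas hp).ennreal_ofReal (by simp)]
  simp only [ENNReal.toReal_ofReal (dmf_nonneg hp0 _)]
  rw [Real.circleAverage_def, intervalIntegral.integral_of_le (by positivity),
    ← integral_Ico_eq_integral_Ioc, ← integral_smul, ← integral_indicator measurableSet_Ico]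
  congr 1; ext θ
  simp only [dmf, Set.indicator_apply, circleMap_ctheta]
  split_ifs
  · rw [smul_smul]; congr 1; ring
  · simp

end DM

lemma avg_Ck {G : ℂ → ℂ} (hG : DiffContOnCl ℂ G (Metric.ball 0 1)) {w : ℂ} (hw : ‖w‖ < 1) :
    Real.circleAverage (fun z => Ck w z * G z) 0 1 = G w := by
  have := DiffContOnCl.circleAverage_smul_div (R := 1) (c := 0) (w := w) (by simpa using hG)
    (by simpa using hw)
  rw [← this]
  apply Real.circleAverage_congr_sphere
  intro z hz
  simp only [abs_one, mem_sphere_iff_norm, sub_zero] at hz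
  have h1 := Ck_ne hw hz
  have hzz := conj_mul_one hz
  have h2 : z - w ≠ 0 := by
    intro h
    have : z = w := by linear_combination h
    rw [this] at hz; linarith
  simp only [sub_zero, smul_eq_mul, Ck]
  field_simp
  linear_combination (w*G z) * hzz

lemma avg_conj (φ : ℂ → ℂ) :
    Real.circleAverage (fun z => conj (φ z)) 0 1 = conj (Real.circleAverage φ 0 1) := by
  rw [Real.circleAverage_def, Real.circleAverage_def,
    intervalIntegral.integral_of_le (by positivity), intervalIntegral.integral_of_le (by positivity),
    integral_conj]
  simp only [Complex.real_smul, map_mul, Complex.conj_ofReal]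

lemma avg_Ck_conj {G : ℂ → ℂ} (hG : DiffContOnCl ℂ G (Metric.ball 0 1)) {w : ℂ} (hw : ‖w‖ < 1) :
    Real.circleAverage (fun z => Ck w z * conj (G z)) 0 1 = conj (G 0) := by
  have h1 : DiffContOnCl ℂ (fun z => (1 - conj w * z)⁻¹) (Metric.ball 0 1) := by
    apply DifferentiableOn.diffContOnCl
    intro z hz
    apply DifferentiableAt.differentiableWithinAt
    have : 1 - conj w * z ≠ 0 := by
      apply one_sub_ne (by simpa using hw)
      rw [closure_ball _ one_ne_zero] at hz
      simpa using hz
    fun_prop (disch := assumption)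
  have h2 := DiffContOnCl.circleAverage (R := 1) (c := 0)
    (f := fun z => (1 - conj w * z)⁻¹ • G z) (by simpa using h1.smul hG)
  simp only [mul_zero, sub_zero, inv_one, one_smul] at h2
  rw [← h2, ← avg_conj]
  congr 1; ext z
  simp [Ck]

lemma circInt_of_cont {E : Type*} [NormedAddCommGroup E] {φ : ℂ → E} (h : ContinuousOn φ Sph) :
    CircleIntegrable φ 0 1 := h.circleIntegrable (by norm_num)

lemma int_Ck_DM {p : ℂ → ℝ} (hp : ContinuousOn p Sph) (hp0 : ∀ z ∈ Sph, 0 ≤ p z)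
    {G : ℂ → ℂ} (hG : DiffContOnCl ℂ G (Metric.ball 0 1)) (hG0 : G 0 = 1)
    (hpG : ∀ z, ‖z‖ = 1 → (p z : ℂ) = G z + conj (G z) - 1) {w : ℂ} (hw : ‖w‖ < 1) :
    ∫ θ, Ck w (ctheta θ) ∂(DM p) = G w := by
  rw [DM_int hp hp0]
  have hone : DiffContOnCl ℂ (fun _ : ℂ => (1:ℂ)) (Metric.ball 0 1) := diffContOnCl_const
  have hGc : ContinuousOn G Sph := hG.continuousOn.mono (by
    rw [closure_ball _ one_ne_zero]; exact Metric.sphere_subset_closedBall)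
  have hCc := Ck_cont hw
  have hGc' : ContinuousOn (fun z => conj (G z)) Sph :=
    (RCLike.continuous_conj (K := ℂ)).comp_continuousOn hGc
  have e : Real.circleAverage (fun z => p z • Ck w z) 0 1
    = Real.circleAverage (fun z => (Ck w z * G z + Ck w z * conj (G z)) - Ck w z * 1) 0 1 := by
    apply Real.circleAverage_congr_sphere
    intro z hz
    simp only [abs_one, mem_sphere_iff_norm, sub_zero] at hz
    simp only [Complex.real_smul, hpG z hz]; ring
  have i1 := circInt_of_cont (φ := fun z => Ck w z * G z) (hCc.mul hGc)
  have i2 := circInt_of_cont (φ := fun z => Ck w z * conj (G z)) (hCc.mul hGc')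
  have i3 := circInt_of_cont (φ := fun z => Ck w z * 1) (hCc.mul continuousOn_const)
  have i4 : CircleIntegrable (fun z => Ck w z * G z + Ck w z * conj (G z)) 0 1 := i1.add i2
  rw [e, Real.circleAverage_fun_sub i4 i3, Real.circleAverage_fun_add i1 i2,
    avg_Ck hG hw, avg_Ck_conj hG hw, avg_Ck hone hw, hG0]
  simp

def QQ (n : ℕ) (g : ℂ → ℂ) (c : ℂ) : ℂ[X] := (ND n g c).2 - X * (ND n g c).1

def kc (n : ℕ) (g : ℂ → ℂ) (c : ℂ) : ℝ := kap n g * (1 - ‖c‖^2)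

def wt (n : ℕ) (g : ℂ → ℂ) (c z : ℂ) : ℝ := kc n g c / ‖(QQ n g c).eval z‖^2

lemma kc_pos {n : ℕ} {g : ℂ → ℂ} {c : ℂ} (hs : AllStr n g) (hc : ‖c‖ < 1) : 0 < kc n g c :=
  mul_pos (kap_pos n g hs) (by nlinarith [norm_nonneg c])

lemma QQ_ne {n : ℕ} {g : ℂ → ℂ} {c z : ℂ} (hs : AllStr n g) (hc : ‖c‖ < 1) (hz : ‖z‖ ≤ 1) :
    (QQ n g c).eval z ≠ 0 := by
  intro h
  simp only [QQ, eval_sub, eval_mul, eval_X] at h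
  have h1 := ND_lt n g c z hs hc hz
  rw [sub_eq_zero.1 h, norm_mul] at h1
  nlinarith [norm_nonneg ((ND n g c).1.eval z)]

lemma QQ_deg (n : ℕ) (g : ℂ → ℂ) (c : ℂ) : (QQ n g c).natDegree ≤ n + 1 := by
  obtain ⟨h1, h2⟩ := ND_deg n g c
  have h3 : (X * (ND n g c).1).natDegree ≤ n + 1 := by
    refine natDegree_mul_le.trans ?_
    have := natDegree_X_le (R := ℂ)
    omega
  exact (natDegree_sub_le _ _).trans (max_le (by omega) h3)

lemma QQ_zero (n : ℕ) (g : ℂ → ℂ) (c : ℂ) : (QQ n g c).eval 0 = 1 := by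
  simp [QQ, ND_zero]

lemma QQ_cont (n : ℕ) (g : ℂ → ℂ) (i : ℕ) : Continuous (fun c => (QQ n g c).coeff i) := by
  simp only [QQ, coeff_sub]
  refine (ND_cont n g i).2.sub ?_
  cases i with
  | zero => simp only [coeff_X_mul_zero]; exact continuous_const
  | succ i => simp only [coeff_X_mul]; exact (ND_cont n g i).1

section wt
variable {n : ℕ} {g : ℂ → ℂ} {c : ℂ}

lemma wt_pos (hs : AllStr n g) (hc : ‖c‖ < 1) {z : ℂ} (hz : ‖z‖ = 1) : 0 < wt n g c z :=
  div_pos (kc_pos hs hc) (by have := norm_pos_iff.2 (QQ_ne hs hc hz.le); positivity)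

lemma wt_cont (hs : AllStr n g) (hc : ‖c‖ < 1) : ContinuousOn (wt n g c) Sph := by
  unfold wt
  apply ContinuousOn.div continuousOn_const
  · exact ((QQ n g c).continuous.norm.pow 2).continuousOn
  · intro z hz
    have := norm_pos_iff.2 (QQ_ne hs hc (z := z) (by simp at hz; exact hz.le)); positivity

lemma wt_eq (hs : AllStr n g) (hc : ‖c‖ < 1) {z : ℂ} (hz : ‖z‖ = 1) :
    (wt n g c z : ℂ) = (ND n g c).2.eval z / (QQ n g c).eval z
      + conj ((ND n g c).2.eval z / (QQ n g c).eval z) - 1 := by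
  have h1 := QQ_ne hs hc hz.le
  have h2 := (map_ne_zero (starRingEnd ℂ)).2 h1
  have h3 := ND_circle n g c z hz
  have hzz := conj_mul_one hz
  have h4 : ((kc n g c : ℝ) : ℂ) = (ND n g c).2.eval z * conj ((ND n g c).2.eval z) -
      (ND n g c).1.eval z * conj ((ND n g c).1.eval z) := by
    rw [kc, ← h3]; push_cast; rw [Complex.mul_conj', Complex.mul_conj']
  have h5 : (QQ n g c).eval z = (ND n g c).2.eval z - z * (ND n g c).1.eval z := by simp [QQ]
  have h6 : ((‖(QQ n g c).eval z‖^2 : ℝ) : ℂ) = (QQ n g c).eval z * conj ((QQ n g c).eval z) := by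
    push_cast; rw [Complex.mul_conj']
  rw [wt, Complex.ofReal_div, h6, h4, map_div₀]
  field_simp
  rw [h5, map_sub, map_mul]
  linear_combination (-(ND n g c).1.eval z * conj ((ND n g c).1.eval z)) * (-hzz)

lemma DQ_diff (hs : AllStr n g) (hc : ‖c‖ < 1) :
    DiffContOnCl ℂ (fun z => (ND n g c).2.eval z / (QQ n g c).eval z) (Metric.ball 0 1) := by
  apply DifferentiableOn.diffContOnCl
  intro z hz
  rw [closure_ball _ one_ne_zero] at hz
  have := QQ_ne hs hc (z := z) (by simpa using hz)
  apply DifferentiableAt.differentiableWithinAt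
  exact ((ND n g c).2.differentiable _).div ((QQ n g c).differentiable _) this

lemma int_Ck_wt (hs : AllStr n g) (hc : ‖c‖ < 1) {w : ℂ} (hw : ‖w‖ < 1) :
    ∫ θ, Ck w (ctheta θ) ∂(DM (wt n g c)) = (ND n g c).2.eval w / (QQ n g c).eval w :=
  int_Ck_DM (wt_cont hs hc) (fun z hz => (wt_pos hs hc (by simpa using hz)).le)
    (DQ_diff hs hc) (by simp [QQ_zero, ND_zero]) (fun z hz => wt_eq hs hc hz) hw

end wt

lemma int_Ck_nu {ν : Measure ℝ} [IsProbabilityMeasure ν] {f : ℂ → ℂ} (hf : IsSchurFn ν f)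
    {w : ℂ} (hw : ‖w‖ < 1) : ∫ θ, Ck w (ctheta θ) ∂ν = 1 / (1 - w * f w) := by
  have hwb : w ∈ Metric.ball (0:ℂ) 1 := by simpa using hw
  have h1 := hf.2.2 w hwb
  have hne := one_sub_ne hw (hf.2.1 w hwb)
  have h2 : Cara ν w = 2 * (∫ θ, Ck w (ctheta θ) ∂ν) - 1 := by
    have : ∫ θ, (2 * Ck w (ctheta θ) - 1) ∂ν = 2 * (∫ θ, Ck w (ctheta θ) ∂ν) - 1 := by
      rw [integral_sub ((intg' (Ck_cont hw) ν).const_mul 2) (integrable_const _),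
        integral_const_mul]
      simp
    rw [← this, Cara]
    congr 1; ext θ
    have hz := ctheta_norm θ
    have h1 := Ck_ne hw hz
    have hzz := conj_mul_one hz
    have h2 : ctheta θ - w ≠ 0 := by
      intro h
      have : ctheta θ = w := by linear_combination h
      rw [this] at hz; linarith
    simp only [Ck]
    field_simp
    linear_combination (-2*w) * hzz
  rw [h2] at h1
  rw [eq_div_iff hne]
  linear_combination h1 / 2

lemma Lf_real (μ₁ μ₂ : Measure ℝ) (p : ℂ → ℝ) : Lf μ₁ μ₂ (fun z => (p z : ℂ)) =
    ((∫ θ, p (ctheta θ) ∂μ₁ - ∫ θ, p (ctheta θ) ∂μ₂ : ℝ) : ℂ) := by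
  rw [Lf, Complex.ofReal_sub]
  congr 1
  · exact integral_ofReal
  · exact integral_ofReal

lemma match_exists {ν : Measure ℝ} [IsProbabilityMeasure ν] {f : ℂ → ℂ} (hf : IsSchurFn ν f)
    {n : ℕ} (hs : AllStr n f) : ∃ K : ℂ, ∀ c : ℂ, ‖c‖ < 1 → ∃ U : ℂ → ℂ, ContinuousAt U 0 ∧
      (∀ w : ℂ, ‖w‖ < 1 → Lf ν (DM (wt n f c)) (Ck w) = w^(n+1) * U w) ∧
      (∀ w : ℂ, ‖w‖ < 1 → (schurStep^[n] f) w = c → U w = 0) ∧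
      U 0 = K * ((schurStep^[n] f) 0 - c) := by
  obtain ⟨E, hE, hE0, hfn, hm⟩ := ND_match n f hs ⟨hf.1, hf.2.1⟩
  have hb : Metric.ball (0:ℂ) 1 ∈ 𝓝 (0:ℂ) := Metric.ball_mem_nhds _ one_pos
  refine ⟨kap n f / E 0, fun c hc => ⟨fun w => (kap n f * ((schurStep^[n] f) w - c)) /
    (E w * (1 - w * f w) * (QQ n f c).eval w), ?_, ?_, ?_, ?_⟩⟩
  · have c1 := hE.continuousAt hb
    have c2 := hfn.continuousAt hb
    have c3 := hf.1.continuousOn.continuousAt hb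
    have c4 := (QQ n f c).continuous.continuousAt (x := 0)
    refine ContinuousAt.div (by fun_prop) (by fun_prop) ?_
    simp [QQ_zero, hE0 0 zero_mem_b]
  · intro w hw
    have hwb : w ∈ Metric.ball (0:ℂ) 1 := by simpa using hw
    have h1 := one_sub_ne hw (hf.2.1 w hwb)
    have h2 := QQ_ne hs hc hw.le
    have h3 := hE0 w hwb
    have h4 := hm c w hwb
    rw [Lf, int_Ck_nu hf hw, int_Ck_wt hs hc hw]
    have h5 : (QQ n f c).eval w = (ND n f c).2.eval w - w * (ND n f c).1.eval w := by simp [QQ]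
    rw [pow_succ]
    field_simp
    rw [h5]
    linear_combination w * h4
  · intro w hw h; simp [h]
  · simp [QQ_zero]; ring

lemma AllStr_snoc : ∀ (n : ℕ) (g : ℂ → ℂ), AllStr n g → Str (schurStep^[n] g) → AllStr (n+1) g
  | 0, g, _, h => ⟨h, trivial⟩
  | n+1, g, hs, h => ⟨hs.1, AllStr_snoc n (schurStep g) hs.2 (by simpa using h)⟩

lemma AllStr_last : ∀ (n : ℕ) (g : ℂ → ℂ), AllStr (n+1) g → Str (schurStep^[n] g)
  | 0, g, h => h.1
  | n+1, g, hs => by simpa using AllStr_last n (schurStep g) hs.2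

lemma AllStr_sch : ∀ (n : ℕ) (g : ℂ → ℂ), AllStr n g → Sch g → Sch (schurStep^[n] g)
  | 0, g, _, h => h
  | n+1, g, hs, _ => by simpa using AllStr_sch n (schurStep g) hs.2 (step_props hs.1).1

lemma int_Q_wt {n : ℕ} {g : ℂ → ℂ} {c : ℂ} (hs : AllStr n g) (hc : ‖c‖ < 1) (p : ℂ → ℝ) :
    ∫ θ, ‖(QQ n g c).eval (ctheta θ)‖^2 * p (ctheta θ) ∂(DM (wt n g c))
      = kc n g c * Real.circleAverage p 0 1 := by
  rw [DM_int (φ := fun z => ‖(QQ n g c).eval z‖^2 * p z) (wt_cont hs hc)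
    (fun z hz => (wt_pos hs hc (by simpa using hz)).le), ← smul_eq_mul, ← Real.circleAverage_fun_smul]
  apply Real.circleAverage_congr_sphere
  intro z hz
  simp only [abs_one, mem_sphere_iff_norm, sub_zero] at hz
  have := norm_pos_iff.2 (QQ_ne hs hc hz.le)
  simp only [smul_eq_mul, wt]
  field_simp

lemma ctheta_inj : Set.InjOn ctheta (Ico 0 (2*π)) := by
  intro x hx y hy h
  have h' : circleMap 0 1 x = circleMap 0 1 y := by rw [circleMap_ctheta, circleMap_ctheta, h]
  refine injOn_circleMap_of_abs_sub_le' (c := 0) (R := 1) (a := 0) (b := 2*π) one_ne_zero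
    (by simp) ?_ ?_ h'
  · exact hx
  · exact hy

lemma zero_contra {ν : Measure ℝ} [IsProbabilityMeasure ν] (hcirc : ν (Ico 0 (2*π))ᶜ = 0)
    (hnt : InfiniteSupport ν) (Q : ℂ[X]) (hQ : Q ≠ 0)
    (h : ∫ θ, ‖Q.eval (ctheta θ)‖^2 ∂ν ≤ 0) : False := by
  have hcont : ContinuousOn (fun z => ‖Q.eval z‖^2) Sph := (Q.continuous.norm.pow 2).continuousOn
  have h0 : ∫ θ, ‖Q.eval (ctheta θ)‖^2 ∂ν = 0 := le_antisymm h (integral_nonneg fun _ => by positivity)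
  rw [integral_eq_zero_iff_of_nonneg (fun _ => by positivity) (intg' hcont ν)] at h0
  have hfin : (Ico 0 (2*π) ∩ ctheta ⁻¹' (↑Q.roots.toFinset)).Finite := by
    apply Set.Finite.of_finite_image (f := ctheta)
    · exact (Q.roots.toFinset.finite_toSet).subset (by
        rintro _ ⟨x, ⟨_, hx⟩, rfl⟩; exact hx)
    · exact ctheta_inj.mono inter_subset_left
  apply hnt hfin.toFinset
  have hae : ∀ᵐ θ ∂ν, θ ∈ Ico 0 (2*π) := hcirc
  have : ∀ᵐ θ ∂ν, θ ∈ (hfin.toFinset : Set ℝ) := by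
    filter_upwards [h0, hae] with θ h1 h2
    simp only [Set.Finite.coe_toFinset]
    refine ⟨h2, ?_⟩
    simp only [Pi.zero_apply, ne_eq, OfNat.ofNat_ne_zero, not_false_eq_true, pow_eq_zero_iff,
      norm_eq_zero] at h1
    simp [hQ, h1]
  exact this

lemma strict_last {ν : Measure ℝ} [IsProbabilityMeasure ν] (hcirc : ν (Ico 0 (2*π))ᶜ = 0)
    (hnt : InfiniteSupport ν) {f : ℂ → ℂ} (hf : IsSchurFn ν f) {n : ℕ} (hs : AllStr n f) :
    Str (schurStep^[n] f) := by
  have hsch := AllStr_sch n f hs ⟨hf.1, hf.2.1⟩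
  apply hsch.str
  by_contra hcon
  set a := (schurStep^[n] f) 0 with ha
  have ha1 : ‖a‖ = 1 := le_antisymm (hsch.2 0 zero_mem_b) (not_lt.1 hcon)
  obtain ⟨K, hK⟩ := match_exists hf hs
  -- the mass function
  let L : ℂ → ℝ := fun c => ∫ θ, ‖(QQ n f c).eval (ctheta θ)‖^2 ∂ν
  let Rr : ℂ → ℝ := fun c => kc n f c + ∑ i ∈ Finset.range (n+2), ∑ j ∈ Finset.range (n+2),
      ‖(QQ n f c).coeff i‖ * ‖(QQ n f c).coeff j‖ * (‖K‖ * ‖a - c‖)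
  have hLz : ∀ c, (L c : ℂ) = ∑ i ∈ Finset.range (n+2), ∑ j ∈ Finset.range (n+2),
      ((QQ n f c).coeff i * conj ((QQ n f c).coeff j)) *
        Lf ν 0 (fun z => z^i * (conj z)^j * ((1:ℝ) : ℂ)) := by
    intro c
    have := Lf_normSq ν 0 (fun _ => 1) continuousOn_const (QQ n f c) (n+1) (QQ_deg n f c)
    rw [← this, Lf]
    simp only [mul_one, integral_zero_measure, sub_zero, L]
    exact integral_ofReal.symm
  have hLc : Continuous L := by
    have : Continuous (fun c => (L c : ℂ)) := by
      simp only [hLz]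
      refine continuous_finsetSum _ fun i _ => continuous_finsetSum _ fun j _ => ?_
      have h1 := QQ_cont n f i
      have h2 := QQ_cont n f j
      exact (h1.mul (RCLike.continuous_conj.comp h2)).mul continuous_const
    exact (Complex.continuous_re.comp this).congr fun c => by simp
  have hRc : Continuous Rr := by
    refine Continuous.add (by unfold kc; fun_prop) ?_
    refine continuous_finsetSum _ fun i _ => continuous_finsetSum _ fun j _ => ?_
    have h1 := QQ_cont n f i
    have h2 := QQ_cont n f j
    fun_prop
  have hle : ∀ c, ‖c‖ < 1 → L c ≤ Rr c := by
    intro c hc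
    obtain ⟨U, hU, hUw, _, hU0⟩ := hK c hc
    have := DM_finite (wt_cont hs hc)
    have h1 := Lf_normSq ν (DM (wt n f c)) (fun _ => 1) continuousOn_const (QQ n f c) (n+1)
      (QQ_deg n f c)
    have h2 : Lf ν (DM (wt n f c)) (fun z => ((‖(QQ n f c).eval z‖^2 * 1 : ℝ) : ℂ))
        = ((L c - kc n f c : ℝ) : ℂ) := by
      have h3 := int_Q_wt hs hc (fun _ => 1)
      rw [Real.circleAverage_const, mul_one] at h3
      rw [Lf_real, h3]
      simp [L]
    have h4 : L c - kc n f c ≤ ∑ i ∈ Finset.range (n+2), ∑ j ∈ Finset.range (n+2),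
      ‖(QQ n f c).coeff i‖ * ‖(QQ n f c).coeff j‖ * (‖K‖ * ‖a - c‖) := by
      have h5 : L c - kc n f c ≤ ‖((L c - kc n f c : ℝ) : ℂ)‖ := by
        rw [Complex.norm_real]; exact le_abs_self _
      refine h5.trans ?_
      rw [← h2, h1]
      refine (norm_sum_le _ _).trans (Finset.sum_le_sum fun i hi => ?_)
      refine (norm_sum_le _ _).trans (Finset.sum_le_sum fun j hj => ?_)
      rw [norm_mul, norm_mul, RCLike.norm_conj]
      refine mul_le_mul_of_nonneg_left ?_ (by positivity)
      rw [← norm_mul, ← hU0, Lf_pow_pow]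
      have hpw : ∀ j ≤ n+1, ‖Lf ν (DM (wt n f c)) (fun z => (conj z)^j * (((fun _ => 1) z : ℝ) : ℂ))‖
          ≤ ‖U 0‖ := by
        intro j hj
        have := Lf_pow ν (DM (wt n f c)) (n+1) U hU hUw j hj
        simp only [Complex.ofReal_one, mul_one]
        rw [this, norm_mul, norm_pow, norm_zero]
        exact mul_le_of_le_one_left (norm_nonneg _) (pow_le_one₀ le_rfl zero_le_one)
      simp only [Finset.mem_range] at hi hj
      split_ifs
      · exact hpw _ (by omega)
      · rw [RCLike.norm_conj]; exact hpw _ (by omega)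
    simp only [Rr]; linarith
  have hcl : closure (Metric.ball (0:ℂ) 1) ⊆ {c | L c ≤ Rr c} :=
    closure_minimal (fun c hc => hle c (by simpa using hc)) (isClosed_le hLc hRc)
  have hfin : L a ≤ Rr a := hcl (by rw [closure_ball _ one_ne_zero]; simp [ha1])
  have hR0 : Rr a = 0 := by simp [Rr, kc, ha1]
  refine zero_contra hcirc hnt (QQ n f a) ?_ (hfin.trans hR0.le)
  intro h
  have := QQ_zero n f a
  rw [h] at this; simp at this

lemma allStr {ν : Measure ℝ} [IsProbabilityMeasure ν] (hcirc : ν (Ico 0 (2*π))ᶜ = 0)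
    (hnt : InfiniteSupport ν) {f : ℂ → ℂ} (hf : IsSchurFn ν f) (n : ℕ) : AllStr n f := by
  induction n with
  | zero => trivial
  | succ n ih => exact AllStr_snoc n f ih (strict_last hcirc hnt hf ih)

lemma str_n {ν : Measure ℝ} [IsProbabilityMeasure ν] (hcirc : ν (Ico 0 (2*π))ᶜ = 0)
    (hnt : InfiniteSupport ν) {f : ℂ → ℂ} (hf : IsSchurFn ν f) (n : ℕ) : Str (schurStep^[n] f) :=
  strict_last hcirc hnt hf (allStr hcirc hnt hf n)

lemma pk_pos {ζ z : ℂ} (hζ : ‖ζ‖ < 1) (hz : z ∈ Sph) : 0 < poissonKernel 0 ζ z := by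
  simp only [mem_sphere_iff_norm, sub_zero] at hz
  rw [poissonKernel_def]
  have h2 : z - ζ ≠ 0 := by
    intro h
    have : z = ζ := by linear_combination h
    rw [this] at hz; linarith
  have := norm_pos_iff.2 h2
  simp only [sub_zero, hz]
  apply div_pos _ (by positivity)
  nlinarith [norm_nonneg ζ]

lemma pk_cont {ζ : ℂ} (hζ : ‖ζ‖ < 1) : ContinuousOn (poissonKernel 0 ζ) Sph := by
  have : (poissonKernel 0 ζ) = fun z => (‖z - 0‖ ^ 2 - ‖ζ - 0‖ ^ 2) / ‖(z - 0) - (ζ - 0)‖ ^ 2 := by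
    ext z; exact poissonKernel_def _ _ _
  rw [this]
  apply ContinuousOn.div (by fun_prop) (by fun_prop)
  intro z hz
  simp only [mem_sphere_iff_norm, sub_zero] at hz
  have h2 : z - ζ ≠ 0 := by
    intro h
    have : z = ζ := by linear_combination h
    rw [this] at hz; linarith
  have := norm_pos_iff.2 h2
  simp only [sub_zero]
  positivity

lemma int_Pois {E : Type*} [NormedAddCommGroup E] [NormedSpace ℝ E] {ζ : ℂ} (hζ : ‖ζ‖ < 1)
    (φ : ℂ → E) :
    ∫ θ, φ (ctheta θ) ∂(PoisM ζ) = Real.circleAverage (fun z => poissonKernel 0 ζ z • φ z) 0 1 := by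
  rw [PoisM_eq, DM_int (pk_cont hζ) (fun z hz => (pk_pos hζ hz).le)]

lemma avg_pk {ζ : ℂ} (hζ : ‖ζ‖ < 1) : Real.circleAverage (poissonKernel 0 ζ) 0 1 = 1 := by
  have h : InnerProductSpace.HarmonicOnNhd (fun _ : ℂ => (1:ℝ)) (Metric.closedBall 0 1) :=
    fun z _ => InnerProductSpace.harmonicAt_const _
  have := h.circleAverage_poissonKernel_smul (w := ζ) (by simpa using hζ)
  rw [← this]
  congr 1; ext z; simp

lemma pois_prob {ζ : ℂ} (hζ : ‖ζ‖ < 1) : IsProbabilityMeasure (PoisM ζ) := by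
  have : IsFiniteMeasure (PoisM ζ) := by rw [PoisM_eq]; exact DM_finite (pk_cont hζ)
  have h := int_Pois hζ (fun _ => (1:ℝ))
  simp only [smul_eq_mul, mul_one, integral_const] at h
  rw [show (fun z => poissonKernel 0 ζ z) = poissonKernel 0 ζ from rfl, avg_pk hζ] at h
  constructor
  rw [Measure.real, ENNReal.toReal_eq_one_iff] at h
  exact h

lemma norm_flip {ζ z : ℂ} (hz : ‖z‖ = 1) : ‖z - ζ‖ = ‖1 - conj ζ * z‖ := by
  have hzz := conj_mul_one hz
  have : z - ζ = z * conj (1 - conj ζ * z) := by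
    simp only [map_sub, map_mul, map_one, Complex.conj_conj]
    linear_combination (ζ) * hzz
  rw [this, norm_mul, hz, RCLike.norm_conj, one_mul]

def Rn (ζ : ℂ) (f : ℂ → ℂ) (n : ℕ) : ℝ :=
  Real.log (‖1 - ζ * f ζ‖^2 / ((1 - ‖ζ‖^2) * (1 - ‖f ζ‖^2)))
    + ∑ k ∈ Finset.range n, tm ζ (schurStep^[k+1] f)

lemma int_log_pk {ζ : ℂ} (hζ : ‖ζ‖ < 1) {n : ℕ} {g : ℂ → ℂ} {c : ℂ} (hs : AllStr n g)
    (hc : ‖c‖ < 1) :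
    ∫ θ, Real.log (poissonKernel 0 ζ (ctheta θ) / wt n g c (ctheta θ)) ∂(PoisM ζ) =
      - Real.log (1 - ‖ζ‖^2) + 2 * Real.log ‖(QQ n g c).eval ζ‖ - Real.log (kc n g c) := by
  have hζ2 : 0 < 1 - ‖ζ‖^2 := by nlinarith [norm_nonneg ζ]
  let F : ℂ → ℝ := fun z => (Real.log (1 - ‖ζ‖^2) - Real.log (kc n g c)) +
    ((-2:ℝ) • (fun z => Real.log ‖1 - conj ζ * z‖) + (2:ℝ) • (fun z => Real.log ‖(QQ n g c).eval z‖)) z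
  have hne : ∀ z, ‖z‖ ≤ 1 → 1 - conj ζ * z ≠ 0 := fun z hz => one_sub_ne (by simpa using hζ) hz
  have hF : InnerProductSpace.HarmonicOnNhd F (Metric.closedBall 0 1) := by
    intro z hz
    have hz' : ‖z‖ ≤ 1 := by simpa using hz
    have h1 : InnerProductSpace.HarmonicAt (fun z => Real.log ‖1 - conj ζ * z‖) z :=
      AnalyticAt.harmonicAt_log_norm (f := fun z => 1 - conj ζ * z) (by fun_prop) (hne z hz')
    have h2 : InnerProductSpace.HarmonicAt (fun z => Real.log ‖(QQ n g c).eval z‖) z :=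
      AnalyticAt.harmonicAt_log_norm (f := fun z => (QQ n g c).eval z)
        ((QQ n g c).differentiable.analyticAt z) (QQ_ne hs hc hz')
    exact (InnerProductSpace.harmonicAt_const _).add ((h1.const_smul).add (h2.const_smul))
  have h := hF.circleAverage_poissonKernel_smul (w := ζ) (by simpa using hζ)
  rw [int_Pois hζ (fun z => Real.log (poissonKernel 0 ζ z / wt n g c z))]
  have e : Real.circleAverage (fun z => poissonKernel 0 ζ z •
      Real.log (poissonKernel 0 ζ z / wt n g c z)) 0 1 = F ζ := by
    rw [← h]
    apply Real.circleAverage_congr_sphere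
    intro z hz
    simp only [abs_one, mem_sphere_iff_norm, sub_zero] at hz
    have hq := norm_pos_iff.2 (QQ_ne hs hc hz.le)
    have hn := norm_pos_iff.2 (hne z hz.le)
    have hk := kc_pos hs hc
    simp only [Pi.smul_apply', smul_eq_mul, F, Pi.add_apply, Pi.smul_apply]
    congr 1
    rw [poissonKernel_def, wt]
    simp only [sub_zero, hz, norm_flip hz]
    rw [Real.log_div (by rw [one_pow]; positivity) (by positivity), Real.log_div (by rw [one_pow]; positivity) (by positivity),
      Real.log_div (by positivity) (by positivity), Real.log_pow, Real.log_pow]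
    push_cast
    simp only [one_pow]
    ring
  rw [e]
  simp only [F, Pi.add_apply, Pi.smul_apply, smul_eq_mul]
  have : ‖1 - conj ζ * ζ‖ = 1 - ‖ζ‖^2 := by
    rw [Complex.conj_mul']
    rw [show (1 : ℂ) - (‖ζ‖:ℂ)^2 = ((1 - ‖ζ‖^2 : ℝ) : ℂ) by push_cast; ring, Complex.norm_real,
      Real.norm_of_nonneg hζ2.le]
  rw [this]; ring

lemma Rn_eq {ζ : ℂ} (hζ : ‖ζ‖ < 1) {n : ℕ} {f : ℂ → ℂ} (hs : AllStr n f) (hsch : Sch f)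
    (hf1 : ‖f ζ‖ < 1)
    (hn : ‖(schurStep^[n] f) ζ‖ < 1) :
    ∫ θ, Real.log (poissonKernel 0 ζ (ctheta θ) / wt n f ((schurStep^[n] f) ζ) (ctheta θ)) ∂(PoisM ζ)
     = Rn ζ f n := by
  set c := (schurStep^[n] f) ζ with hc
  have hζ2 : 0 < 1 - ‖ζ‖^2 := by nlinarith [norm_nonneg ζ]
  have hf2 : 0 < 1 - ‖f ζ‖^2 := by nlinarith [norm_nonneg (f ζ)]
  have hb : ζ ∈ Metric.ball (0:ℂ) 1 := by simpa using hζ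
  rw [int_log_pk hζ hs hn, Rn]
  have h1 := ND_entropy ζ hζ n f hs hsch hn
  rw [← hc] at h1
  obtain ⟨E, _, hE0, _, hm⟩ := ND_match n f hs hsch
  have h2 := hm c ζ hb
  rw [← hc, sub_self, mul_zero, mul_zero, mul_eq_zero, or_iff_right (hE0 ζ hb)] at h2
  have h3 : (QQ n f c).eval ζ = (ND n f c).2.eval ζ * (1 - ζ * f ζ) := by
    simp only [QQ, eval_sub, eval_mul, eval_X]; linear_combination ζ * h2
  have hq := QQ_ne hs hn (z := ζ) hζ.le
  rw [h3] at hq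
  have hq1 := norm_pos_iff.2 (left_ne_zero_of_mul hq)
  have hq2 := norm_pos_iff.2 (right_ne_zero_of_mul hq)
  rw [h3, norm_mul, Real.log_mul hq1.ne' hq2.ne', Real.log_div (by positivity) (by positivity),
    Real.log_mul hζ2.ne' hf2.ne', Real.log_pow, kc]
  push_cast
  linarith

lemma package {ζ : ℂ} (hζ : ‖ζ‖ < 1)
    {ν : Measure ℝ} [IsProbabilityMeasure ν] (hcirc : ν (Ico 0 (2*π))ᶜ = 0)
    (hnt : InfiniteSupport ν) {f : ℂ → ℂ} (hf : IsSchurFn ν f) (n : ℕ) :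
    ∃ w : ℂ → ℝ, ContinuousOn w Sph ∧ (∀ z ∈ Sph, 0 < w z) ∧
      ∫ θ, Real.log (poissonKernel 0 ζ (ctheta θ) / w (ctheta θ)) ∂(PoisM ζ) = Rn ζ f n ∧
      ∫ θ, poissonKernel 0 ζ (ctheta θ) / w (ctheta θ) ∂ν = 1 ∧
      ∀ j ≤ n, Lf ν (DM w) (fun z => (conj z)^j) = 0 := by
  have hb : ζ ∈ Metric.ball (0:ℂ) 1 := by simpa using hζ
  have hs := allStr hcirc hnt hf n
  have hn := (str_n hcirc hnt hf n).2 ζ hb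
  set c := (schurStep^[n] f) ζ with hc
  refine ⟨wt n f c, wt_cont hs hn, fun z hz => wt_pos hs hn (by simpa using hz),
    Rn_eq hζ hs ⟨hf.1, hf.2.1⟩ ((str_n hcirc hnt hf 0).2 ζ hb) hn, ?_, ?_⟩
  · obtain ⟨K, hK⟩ := match_exists hf hs
    obtain ⟨U, hU, hUw, hU1, _⟩ := hK c hn
    have := DM_finite (wt_cont hs hn)
    have h1 := Lf_normSq ν (DM (wt n f c)) (poissonKernel 0 ζ) (pk_cont hζ) (QQ n f c) (n+1)
      (QQ_deg n f c)
    rw [Lf_real ν (DM (wt n f c)) (fun z => ‖(QQ n f c).eval z‖^2 * poissonKernel 0 ζ z),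
      int_Q_wt hs hn (poissonKernel 0 ζ), avg_pk hζ] at h1
    have h2 : ∀ i ∈ Finset.range (n+1+1), ∀ j ∈ Finset.range (n+1+1),
        Lf ν (DM (wt n f c)) (fun z => z^i * (conj z)^j * (poissonKernel 0 ζ z : ℂ)) = 0 := by
      intro i hi j hj
      simp only [Finset.mem_range] at hi hj
      have h3 := Lf_poisson ν (DM (wt n f c)) ζ hζ n U hU (hU1 ζ hζ hc.symm) hUw
      rw [Lf_pow_pow]
      split_ifs
      · exact h3 _ (by omega)
      · rw [h3 _ (by omega), map_zero]
    rw [Finset.sum_eq_zero (fun i hi => Finset.sum_eq_zero (fun j hj => by rw [h2 i hi j hj, mul_zero])),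
      Complex.ofReal_eq_zero, mul_one, sub_eq_zero] at h1
    have hk := kc_pos hs hn
    have h4 : ∀ θ, poissonKernel 0 ζ (ctheta θ) / wt n f c (ctheta θ) =
        (‖(QQ n f c).eval (ctheta θ)‖^2 * poissonKernel 0 ζ (ctheta θ)) / kc n f c := by
      intro θ
      rw [wt, div_div_eq_mul_div]; ring
    simp only [h4]
    rw [integral_div, h1, div_self hk.ne']
  · intro j hj
    obtain ⟨K, hK⟩ := match_exists hf hs
    obtain ⟨U, hU, hUw, hU1, _⟩ := hK c hn
    have := DM_finite (wt_cont hs hn)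
    rw [Lf_pow ν (DM (wt n f c)) (n+1) U hU hUw j (by omega), zero_pow (by omega), zero_mul]

lemma F1 {α : Type*} [MeasurableSpace α] {P ν : Measure α} [IsProbabilityMeasure P]
    [IsProbabilityMeasure ν] (hac : P ≪ ν) (hi : Integrable (llr P ν) P) {h : α → ℝ}
    (hP : Integrable h P) (hν : Integrable (fun x => Real.exp (h x)) ν)
    (h1 : ∫ x, Real.exp (h x) ∂ν ≤ 1) : ∫ x, h x ∂P ≤ ∫ x, llr P ν x ∂P := by
  have e1 := integral_llr_tilted_right hac hP hν hi
  have e2 := integrable_llr_tilted_right hac hP hi hν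
  have := isProbabilityMeasure_tilted hν
  have e3 := InformationTheory.integral_llr_add_sub_measure_univ_nonneg
    (hac.trans (absolutelyContinuous_tilted hν)) e2
  simp only [probReal_univ] at e3
  have h0 : 0 ≤ ∫ x, Real.exp (h x) ∂ν := integral_nonneg fun x => (Real.exp_pos _).le
  have := Real.log_nonpos h0 h1
  linarith

lemma F2_ac {α : Type*} [MeasurableSpace α] {P ν : Measure α} [IsProbabilityMeasure P]
    [IsProbabilityMeasure ν] {R : ℝ}
    (H : ∀ (g : α → ℝ) (ε M : ℝ), Measurable g → 0 < ε → (∀ x, ε ≤ g x) → (∀ x, g x ≤ M) →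
      ∫ x, Real.log (g x) ∂P ≤ R + Real.log (∫ x, g x ∂ν)) : P ≪ ν := by
  refine Measure.AbsolutelyContinuous.mk fun A hA h0 => ?_
  by_contra hne
  have hp : 0 < P.real A := by
    rw [measureReal_def]; exact ENNReal.toReal_pos hne (measure_ne_top _ _)
  have key : ∀ t : ℝ, 0 < t → t * P.real A ≤ R := by
    intro t ht
    have h1 := H (fun x => Real.exp (A.indicator (fun _ => t) x)) 1 (Real.exp t)
      (Real.measurable_exp.comp (measurable_const.indicator hA)) one_pos
      (fun x => by
        rw [Real.one_le_exp_iff]; exact indicator_nonneg (fun _ _ => ht.le) x)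
      (fun x => by
        rw [Real.exp_le_exp]; exact indicator_le' (fun _ _ => le_rfl) (fun _ _ => ht.le) x)
    have h2 : ∫ x, Real.exp (A.indicator (fun _ => t) x) ∂ν = 1 := by
      rw [integral_congr_ae (g := fun _ => (1:ℝ))]
      · simp
      · have : ∀ᵐ x ∂ν, x ∉ A := by rw [ae_iff]; simpa using h0
        filter_upwards [this] with x hx
        simp [hx]
    simp only [Real.log_exp, h2, Real.log_one, add_zero] at h1
    rw [integral_indicator_const _ hA] at h1
    simpa [mul_comm] using h1
  have h3 := key ((|R|+1) / P.real A) (by positivity)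
  rw [div_mul_cancel₀ _ hp.ne'] at h3
  linarith [le_abs_self R]

lemma F2 {P ν : Measure ℝ} [IsProbabilityMeasure P]
    [IsProbabilityMeasure ν] {R : ℝ}
    (H : ∀ (g : ℝ → ℝ) (ε M : ℝ), Measurable g → 0 < ε → (∀ x, ε ≤ g x) → (∀ x, g x ≤ M) →
      ∫ x, Real.log (g x) ∂P ≤ R + Real.log (∫ x, g x ∂ν)) :
    P ≪ ν ∧ Integrable (llr P ν) P ∧ ∫ x, llr P ν x ∂P ≤ R := by
  have hac := F2_ac H
  set r : ℝ → ℝ := fun x => (P.rnDeriv ν x).toReal with hr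
  have hrm : Measurable r := (Measure.measurable_rnDeriv P ν).ennreal_toReal
  have hr0 : ∀ x, 0 ≤ r x := fun x => ENNReal.toReal_nonneg
  have hri : Integrable r ν := Measure.integrable_toReal_rnDeriv
  have hr1 : ∫ x, r x ∂ν = 1 := by rw [Measure.integral_toReal_rnDeriv hac]; simp
  have hrpos : ∀ᵐ x ∂P, 0 < r x := by
    filter_upwards [Measure.rnDeriv_pos hac, hac.ae_le (Measure.rnDeriv_lt_top P ν)] with x h1 h2
    exact ENNReal.toReal_pos h1.ne' h2.ne
  let g : ℝ → ℕ → ℝ → ℝ := fun a k x => max a (min (r x) (k+1))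
  have hgm : ∀ a k, Measurable (g a k) := fun a k =>
    measurable_const.max (hrm.min measurable_const)
  have hga : ∀ a k x, a ≤ g a k x := fun a k x => le_max_left _ _
  have hgM : ∀ a (k : ℕ) x, g a k x ≤ max a (k+1) := fun a k x =>
    max_le_max le_rfl (min_le_right _ _)
  have hgr : ∀ a, 0 < a → ∀ k x, g a k x ≤ a + r x := fun a ha k x =>
    max_le (by linarith [hr0 x]) ((min_le_left _ _).trans (by linarith))
  have hb : ∀ a, 0 < a → ∀ k, ∫ x, Real.log (g a k x) ∂P ≤ R + Real.log (1 + a) := by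
    intro a ha k
    refine (H (g a k) a (max a (k+1)) (hgm a k) ha (hga a k) (hgM a k)).trans ?_
    have hgi : Integrable (g a k) ν := Integrable.of_bound (hgm a k).aestronglyMeasurable
      (max a (k+1)) (Eventually.of_forall fun x => by
        rw [Real.norm_of_nonneg (ha.le.trans (hga a k x))]; exact hgM a k x)
    have h1 : ∫ x, g a k x ∂ν ≤ 1 + a := by
      refine (integral_mono hgi ((integrable_const a).add hri) (hgr a ha k)).trans ?_
      rw [Pi.add_def, integral_add (integrable_const a) hri, hr1]; simp [add_comm]
    have h2 : a ≤ ∫ x, g a k x ∂ν := by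
      have := integral_mono (integrable_const a) hgi (hga a k)
      simpa using this
    gcongr
    linarith
  have hlog_lim : ∀ (a : ℕ → ℝ), (∀ᵐ x ∂P, ∀ᶠ k in atTop, a k ≤ r x) →
      ∀ᵐ x ∂P, Tendsto (fun k => Real.log (g (a k) k x)) atTop (𝓝 (Real.log (r x))) := by
    intro a ha
    filter_upwards [ha] with x hx
    refine tendsto_const_nhds.congr' ?_
    filter_upwards [hx, eventually_ge_atTop ⌈r x⌉₊] with k h1 h2
    have h3 : r x ≤ k + 1 := by
      have := (Nat.le_ceil (r x)).trans (Nat.cast_le.2 h2); linarith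
    simp [g, h1, h3]
  -- positive part integrable
  have hpos : Integrable (fun x => Real.log (max 1 (r x))) P := by
    refine integrable_of_tendsto (G := fun k x => Real.log (g 1 k x)) ?_ ?_ ?_
    · refine Eventually.of_forall fun x => ?_
      refine tendsto_const_nhds.congr' ?_
      filter_upwards [eventually_ge_atTop ⌈r x⌉₊] with k h2
      have h3 : r x ≤ k + 1 := by
        have := (Nat.le_ceil (r x)).trans (Nat.cast_le.2 h2); linarith
      simp [g, h3]
    · intro k
      exact (Real.measurable_log.comp (hgm 1 k)).aestronglyMeasurable
    · refine ne_top_of_le_ne_top (ENNReal.ofReal_ne_top (r := R + Real.log (1+1))) ?_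
      refine liminf_le_of_le (by isBoundedDefault) fun b hb' => ?_
      obtain ⟨k, hk⟩ := hb'.exists
      refine hk.trans ?_
      have hi : Integrable (fun x => Real.log (g 1 k x)) P :=
        Integrable.of_bound (Real.measurable_log.comp (hgm 1 k)).aestronglyMeasurable
        (Real.log (max 1 (k+1))) (Eventually.of_forall fun x => by
          rw [Real.norm_of_nonneg (Real.log_nonneg (hga 1 k x))]
          exact Real.log_le_log (by linarith [hga 1 k x]) (hgM 1 k x))
      have h0 : ∀ x, 0 ≤ Real.log (g 1 k x) := fun x => Real.log_nonneg (hga 1 k x)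
      simp_rw [fun x => Real.enorm_of_nonneg (h0 x)]
      rw [← ofReal_integral_eq_lintegral_ofReal hi (Eventually.of_forall h0)]
      exact ENNReal.ofReal_le_ofReal (hb 1 one_pos k)
  have hneg : Integrable (fun x => Real.exp (-llr P ν x)) P :=
    (integrable_congr (exp_neg_llr hac)).2 Measure.integrable_toReal_rnDeriv
  have hbd : ∀ x, 0 < r x → |Real.log (r x)| ≤ Real.log (max 1 (r x)) + Real.exp (-llr P ν x) := by
    intro x hx
    have h1 : 0 ≤ Real.log (max 1 (r x)) := Real.log_nonneg (le_max_left _ _)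
    have h2 : Real.log (r x) ≤ Real.log (max 1 (r x)) := Real.log_le_log hx (le_max_right _ _)
    have h3 := Real.add_one_le_exp (-llr P ν x)
    have h4 : llr P ν x = Real.log (r x) := rfl
    have h5 := Real.exp_pos (-llr P ν x)
    rw [abs_le]; constructor <;> linarith
  have hint : Integrable (llr P ν) P := by
    refine Integrable.mono' (hpos.add hneg) (measurable_llr _ _).aestronglyMeasurable ?_
    filter_upwards [hrpos] with x hx
    exact hbd x hx
  refine ⟨hac, hint, ?_⟩
  let a : ℕ → ℝ := fun k => 1/((k:ℝ)+1)
  have ha : ∀ k, 0 < a k := fun k => by positivity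
  have ha1 : ∀ k, a k ≤ 1 := fun k => by
    simp only [a]; rw [div_le_one (by positivity)]; linarith [Nat.cast_nonneg (α := ℝ) k]
  have hat : Tendsto a atTop (𝓝 0) := tendsto_one_div_add_atTop_nhds_zero_nat
  have hlim : Tendsto (fun k => ∫ x, Real.log (g (a k) k x) ∂P) atTop (𝓝 (∫ x, llr P ν x ∂P)) := by
    refine tendsto_integral_of_dominated_convergence (fun x => |Real.log (r x)|) ?_ hint.abs ?_ ?_
    · intro k; exact (Real.measurable_log.comp (hgm _ k)).aestronglyMeasurable
    · intro k
      filter_upwards [hrpos] with x hx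
      rw [Real.norm_eq_abs]
      have hk : (1:ℝ) ≤ k + 1 := by linarith [Nat.cast_nonneg (α := ℝ) k]
      have hgp := (ha k).trans_le (hga (a k) k x)
      rcases le_total 1 (r x) with h | h
      · rw [abs_of_nonneg (Real.log_nonneg h), abs_of_nonneg]
        · exact Real.log_le_log hgp (max_le ((ha1 k).trans h) (min_le_left _ _))
        · exact Real.log_nonneg (le_max_of_le_right (le_min h hk))
      · have e : min (r x) (k+1) = r x := min_eq_left (h.trans hk)
        have h' : g (a k) k x ≤ 1 := max_le (ha1 k) (by rw [e]; exact h)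
        rw [abs_of_nonpos (Real.log_nonpos hx.le h), abs_of_nonpos (Real.log_nonpos hgp.le h')]
        apply neg_le_neg
        apply Real.log_le_log hx
        simp only [g, e]; exact le_max_right _ _
    · apply hlog_lim
      filter_upwards [hrpos] with x hx
      filter_upwards [hat.eventually (gt_mem_nhds hx)] with k hk
      exact hk.le
  have hlim2 : Tendsto (fun k => R + Real.log (1 + a k)) atTop (𝓝 (R + Real.log (1 + 0))) := by
    refine tendsto_const_nhds.add (Tendsto.log (tendsto_const_nhds.add hat) (by norm_num))
  have := le_of_tendsto_of_tendsto' hlim hlim2 (fun k => hb (a k) (ha k) k)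
  simpa using this

def amap (z : ℂ) : ℝ := if 0 ≤ Complex.arg z then Complex.arg z else Complex.arg z + 2*π

lemma amap_meas : Measurable amap := by
  unfold amap
  refine Measurable.ite ?_ Complex.measurable_arg (Complex.measurable_arg.add_const _)
  exact measurableSet_le measurable_const Complex.measurable_arg

lemma amap_ctheta {θ : ℝ} (h : θ ∈ Ico 0 (2*π)) : amap (ctheta θ) = θ := by
  have hpi := Real.pi_pos
  rcases le_or_gt θ π with h1 | h1
  · have : Complex.arg (ctheta θ) = θ := by
      rw [ctheta, Complex.arg_exp_mul_I, toIocMod_eq_self]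
      constructor <;> linarith [h.1]
    rw [amap, this, if_pos h.1]
  · have : Complex.arg (ctheta θ) = θ - 2*π := by
      rw [ctheta, Complex.arg_exp_mul_I, ← toIocMod_sub, toIocMod_eq_self]
      constructor <;> linarith [h.2]
    rw [amap, this, if_neg (by linarith [h.2])]; ring

lemma log_lip {ε a b : ℝ} (hε : 0 < ε) (ha : ε ≤ a) (hb : ε ≤ b) :
    Real.log a - Real.log b ≤ |a - b| / ε := by
  have ha' := hε.trans_le ha
  have hb' := hε.trans_le hb
  rw [← Real.log_div ha'.ne' hb'.ne']
  have h1 := Real.log_le_sub_one_of_pos (div_pos ha' hb')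
  have h2 : a / b - 1 = (a - b) / b := by field_simp
  rw [h2] at h1
  refine h1.trans ((div_le_div_of_nonneg_right (le_abs_self _) hb'.le).trans ?_)
  exact div_le_div_of_nonneg_left (abs_nonneg _) hε hb

lemma int_bdd {μ : Measure ℝ} [IsFiniteMeasure μ] {g : ℝ → ℝ} {ε M : ℝ} (hg : Measurable g)
    (h1 : ∀ x, ε ≤ g x) (h2 : ∀ x, g x ≤ M) : Integrable g μ :=
  Integrable.of_mem_Icc ε M hg.aemeasurable (Eventually.of_forall fun x => ⟨h1 x, h2 x⟩)

lemma perturb {P ν : Measure ℝ} [IsProbabilityMeasure P] [IsProbabilityMeasure ν]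
    {R ε M δ : ℝ} {g G : ℝ → ℝ} (hg : Measurable g) (hG : Measurable G) (hε : 0 < ε)
    (g1 : ∀ x, ε ≤ g x) (g2 : ∀ x, g x ≤ M) (G1 : ∀ x, ε ≤ G x) (G2 : ∀ x, G x ≤ M)
    (dP : ∫ x, |g x - G x| ∂P ≤ δ) (dν : ∫ x, |g x - G x| ∂ν ≤ δ)
    (H : ∫ x, Real.log (G x) ∂P ≤ R + Real.log (∫ x, G x ∂ν)) :
    ∫ x, Real.log (g x) ∂P ≤ R + Real.log (∫ x, g x ∂ν) + 2 * δ / ε := by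
  have il : ∀ {k : ℝ → ℝ}, Measurable k → (∀ x, ε ≤ k x) → (∀ x, k x ≤ M) →
      Integrable (fun x => Real.log (k x)) P := fun {k} hk k1 k2 =>
    int_bdd (Real.measurable_log.comp hk) (fun x => Real.log_le_log hε (k1 x))
      (fun x => Real.log_le_log (hε.trans_le (k1 x)) (k2 x))
  have ig := int_bdd (μ := ν) hg g1 g2
  have iG := int_bdd (μ := ν) hG G1 G2
  have igP := int_bdd (μ := P) hg g1 g2
  have iGP := int_bdd (μ := P) hG G1 G2
  have a1 : ∫ x, Real.log (g x) ∂P - ∫ x, Real.log (G x) ∂P ≤ δ / ε := by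
    rw [← integral_sub (il hg g1 g2) (il hG G1 G2)]
    refine (integral_mono ((il hg g1 g2).sub (il hG G1 G2)) ((igP.sub iGP).abs.div_const ε)
      (fun x => log_lip hε (g1 x) (G1 x))).trans ?_
    rw [integral_div]
    exact div_le_div_of_nonneg_right dP hε.le
  have lo : ∀ {k : ℝ → ℝ}, Integrable k ν → (∀ x, ε ≤ k x) → ε ≤ ∫ x, k x ∂ν := by
    intro k hk k1
    have := integral_mono (integrable_const ε) hk k1
    simpa using this
  have a2 : Real.log (∫ x, G x ∂ν) - Real.log (∫ x, g x ∂ν) ≤ δ / ε := by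
    refine (log_lip hε (lo iG G1) (lo ig g1)).trans (div_le_div_of_nonneg_right ?_ hε.le)
    rw [abs_sub_comm, ← integral_sub ig iG]
    exact (abs_integral_le_integral_abs).trans dν
  have : 2 * δ / ε = δ/ε + δ/ε := by ring
  linarith

instance : Fact (0 < 2 * π) := ⟨Real.two_pi_pos⟩

lemma int_DM_Pois {ζ : ℂ} (hζ : ‖ζ‖ < 1) {w : ℂ → ℝ} (hw : ContinuousOn w Sph)
    (hw0 : ∀ z ∈ Sph, 0 < w z) (h : ℝ → ℝ) :
    ∫ θ, h θ ∂(DM w) = ∫ θ, h θ * (w (ctheta θ) / poissonKernel 0 ζ (ctheta θ)) ∂(PoisM ζ) := by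
  rw [PoisM_eq, DM_eq, DM_eq,
    integral_withDensity_eq_integral_toReal_smul (dmf_meas hw).ennreal_ofReal
      (Eventually.of_forall fun _ => ENNReal.ofReal_lt_top),
    integral_withDensity_eq_integral_toReal_smul (dmf_meas (pk_cont hζ)).ennreal_ofReal
      (Eventually.of_forall fun _ => ENNReal.ofReal_lt_top)]
  congr 1; ext θ
  rw [ENNReal.toReal_ofReal (dmf_nonneg (fun z hz => (hw0 z hz).le) θ),
    ENNReal.toReal_ofReal (dmf_nonneg (fun z hz => (pk_pos hζ hz).le) θ)]
  have := (pk_pos hζ (ctheta_mem θ)).ne'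
  by_cases hθ : θ ∈ Ico 0 (2*π)
  · simp only [dmf, indicator_of_mem hθ, smul_eq_mul]; field_simp
  · simp [dmf, indicator_of_notMem hθ]

lemma int_AC (T : C(AddCircle (2*π), ℂ)) (μ : Measure ℝ) [IsFiniteMeasure μ] :
    Integrable (fun θ : ℝ => T (θ : AddCircle (2*π))) μ :=
  Integrable.of_bound (T.continuous.comp (AddCircle.continuous_mk' _)).aestronglyMeasurable
    ‖T‖ (Eventually.of_forall fun θ => T.norm_coe_le_norm _)

lemma fourier_ctheta (n : ℤ) (θ : ℝ) :
    fourier n (θ : AddCircle (2*π)) = (ctheta θ)^n := by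
  rw [fourier_coe_apply, ctheta, ← Complex.exp_int_mul]
  congr 1
  have : (π:ℂ) ≠ 0 := by exact_mod_cast Real.pi_ne_zero
  push_cast
  field_simp

lemma span_match (ν : Measure ℝ) [IsProbabilityMeasure ν] (T : C(AddCircle (2*π), ℂ))
    (hT : T ∈ Submodule.span ℂ (range (@fourier (2*π)))) :
    ∃ N : ℕ, ∀ w : ℂ → ℝ, ContinuousOn w Sph →
      (∀ j ≤ N, Lf ν (DM w) (fun z => (conj z)^j) = 0) →
      ∫ θ : ℝ, T (θ : AddCircle (2*π)) ∂ν = ∫ θ : ℝ, T (θ : AddCircle (2*π)) ∂(DM w) := by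
  induction hT using Submodule.span_induction with
  | mem x hx =>
    obtain ⟨n, rfl⟩ := hx
    refine ⟨n.natAbs, fun w hw h => ?_⟩
    have := DM_finite hw
    have h1 := h _ le_rfl
    simp only [fourier_ctheta]
    rcases Int.natAbs_eq n with e | e
    · have h2 := Lf_conj ν (DM w) (fun z => (conj z)^n.natAbs)
      rw [h1, map_zero] at h2
      rw [Lf, sub_eq_zero] at h2
      simp only [map_pow, Complex.conj_conj] at h2
      have h3 : ∀ θ, (ctheta θ)^n = (ctheta θ)^n.natAbs := fun θ => by rw [← zpow_natCast, ← e]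
      simp only [h3]; exact h2
    · rw [Lf, sub_eq_zero] at h1
      have h3 : ∀ θ, (ctheta θ)^n = (conj (ctheta θ))^n.natAbs := by
        intro θ
        rw [e, zpow_neg, zpow_natCast, ← inv_pow, Int.natAbs_neg, Int.natAbs_natCast]
        congr 1
        exact (eq_inv_of_mul_eq_one_left (conj_mul_one (ctheta_norm θ))).symm
      simp only [h3]; exact h1
  | zero => exact ⟨0, fun w _ _ => by simp⟩
  | add x y _ _ hx hy =>
    obtain ⟨N, hN⟩ := hx
    obtain ⟨M, hM⟩ := hy
    refine ⟨max N M, fun w hw h => ?_⟩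
    have := DM_finite hw
    simp only [ContinuousMap.add_apply]
    rw [integral_add (int_AC x _) (int_AC y _), integral_add (int_AC x _) (int_AC y _),
      hN w hw (fun j hj => h j (hj.trans (le_max_left _ _))),
      hM w hw (fun j hj => h j (hj.trans (le_max_right _ _)))]
  | smul a x _ hx =>
    obtain ⟨N, hN⟩ := hx
    refine ⟨N, fun w hw h => ?_⟩
    simp only [ContinuousMap.smul_apply]
    rw [integral_smul, integral_smul, hN w hw h]

section
variable {ζ : ℂ} {ν : Measure ℝ} [IsProbabilityMeasure ν] {f : ℂ → ℂ} {R : ℝ}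

lemma G1 (hζ : ‖ζ‖ < 1) (hcirc : ν (Ico 0 (2*π))ᶜ = 0)
    (hnt : InfiniteSupport ν) (hf : IsSchurFn ν f) (hR : ∀ n, Rn ζ f n ≤ R)
    (T : C(AddCircle (2*π), ℂ))
    (hT : T ∈ Submodule.span ℂ (range (@fourier (2*π)))) (h : ℝ → ℝ)
    (hh : ∀ θ : ℝ, h θ = (T (θ : AddCircle (2*π))).re) {ε : ℝ} (hε : 0 < ε) (hpos : ∀ θ, ε ≤ h θ) :
    ∫ θ, Real.log (h θ) ∂(PoisM ζ) ≤ R + Real.log (∫ θ, h θ ∂ν) := by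
  obtain ⟨N, hN⟩ := span_match ν T hT
  obtain ⟨w, hw, hw0, hw1, -, hw3⟩ := package hζ hcirc hnt hf N
  have := DM_finite hw
  have := pois_prob hζ
  have e1 : ∫ θ, h θ ∂ν = ∫ θ, h θ ∂(DM w) := by
    have h1 := congrArg Complex.re (hN w hw hw3)
    have h2 : ∀ (μ : Measure ℝ) [IsFiniteMeasure μ],
        ∫ θ, h θ ∂μ = (∫ θ : ℝ, T (θ : AddCircle (2*π)) ∂μ).re := by
      intro μ _
      simp only [hh]
      exact integral_re (int_AC T μ)
    rw [h2, h2, h1]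
  have hhc : Continuous h := by
    have : h = fun θ : ℝ => (T (θ : AddCircle (2*π))).re := funext hh
    rw [this]
    exact Complex.continuous_re.comp (T.continuous.comp (AddCircle.continuous_mk' _))
  have hhM : ∀ θ, h θ ≤ ‖T‖ := fun θ => by
    rw [hh]; exact (Complex.re_le_norm _).trans (T.norm_coe_le_norm _)
  have hi := int_bdd (μ := ν) hhc.measurable hpos hhM
  set s := ∫ θ, h θ ∂ν with hs
  have hs0 : 0 < s := by
    have := integral_mono (integrable_const ε) hi hpos
    simp at this; linarith
  rw [int_DM_Pois hζ hw hw0] at e1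
  have hq : ContinuousOn (fun z => w z / poissonKernel 0 ζ z) Sph :=
    hw.div (pk_cont hζ) (fun z hz => (pk_pos hζ hz).ne')
  have hl : ContinuousOn (fun z => Real.log (poissonKernel 0 ζ z / w z)) Sph :=
    ((pk_cont hζ).div hw (fun z hz => (hw0 z hz).ne')).log
      (fun z hz => (div_pos (pk_pos hζ hz) (hw0 z hz)).ne')
  have i1 : Integrable (fun θ => h θ * (w (ctheta θ) / poissonKernel 0 ζ (ctheta θ))) (PoisM ζ) := by
    refine (intg' hq (PoisM ζ)).bdd_mul hhc.aestronglyMeasurable (c := ‖T‖)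
      (Eventually.of_forall fun θ => ?_)
    rw [Real.norm_of_nonneg (hε.le.trans (hpos θ))]; exact hhM θ
  have i2 := intg' hl (PoisM ζ)
  have i3 : Integrable (fun θ => Real.log (h θ)) (PoisM ζ) :=
    int_bdd (Real.measurable_log.comp hhc.measurable) (fun x => Real.log_le_log hε (hpos x))
      (fun x => Real.log_le_log (hε.trans_le (hpos x)) (hhM x))
  have pt : ∀ θ, Real.log (h θ) - Real.log (poissonKernel 0 ζ (ctheta θ) / w (ctheta θ)) ≤
      h θ * (w (ctheta θ) / poissonKernel 0 ζ (ctheta θ)) / s - 1 + Real.log s := by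
    intro θ
    have p1 := hε.trans_le (hpos θ)
    have p2 := pk_pos hζ (ctheta_mem θ)
    have p3 := hw0 _ (ctheta_mem θ)
    have h1 := Real.log_le_sub_one_of_pos
      (show 0 < h θ * (w (ctheta θ) / poissonKernel 0 ζ (ctheta θ)) / s by positivity)
    rw [Real.log_div (by positivity) hs0.ne', Real.log_mul p1.ne' (by positivity),
      Real.log_div p3.ne' p2.ne'] at h1
    rw [Real.log_div p2.ne' p3.ne']
    linarith
  have i4 : Integrable (fun θ => h θ * (w (ctheta θ) / poissonKernel 0 ζ (ctheta θ)) / s - 1)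
    (PoisM ζ) := (i1.div_const s).sub (integrable_const 1)
  have h2 := integral_mono (i3.sub i2) (i4.add (integrable_const (Real.log s))) pt
  simp only [Pi.sub_apply, Pi.add_apply] at h2
  rw [integral_sub i3 i2, integral_add i4 (integrable_const (Real.log s)), hw1,
    integral_sub (i1.div_const s) (integrable_const 1), integral_div, ← e1, div_self hs0.ne'] at h2
  simp at h2
  linarith [hR N]

lemma G2 (hζ : ‖ζ‖ < 1) (hcirc : ν (Ico 0 (2*π))ᶜ = 0)
    (hnt : InfiniteSupport ν) (hf : IsSchurFn ν f) (hR : ∀ n, Rn ζ f n ≤ R)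
    (G : ℂ → ℝ) (hG : Continuous G) {ε M : ℝ} (hε : 0 < ε) (h1 : ∀ z, ε ≤ G z)
    (h2 : ∀ z, G z ≤ M) :
    ∫ θ, Real.log (G (ctheta θ)) ∂(PoisM ζ) ≤ R + Real.log (∫ θ, G (ctheta θ) ∂ν) := by
  have := pois_prob hζ
  let GC : C(AddCircle (2*π), ℂ) := ⟨fun x => ((G (AddCircle.toCircle x : ℂ) : ℝ) : ℂ), by
    have := (AddCircle.continuous_toCircle (T := 2*π))
    fun_prop⟩
  have hGC : ∀ θ : ℝ, GC (θ : AddCircle (2*π)) = (G (ctheta θ) : ℂ) := by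
    intro θ
    have := fourier_ctheta 1 θ
    rw [fourier_one, zpow_one] at this
    simp only [GC, ContinuousMap.coe_mk, this]
  have hcl : GC ∈ (Submodule.span ℂ (range (@fourier (2*π)))).topologicalClosure := by
    rw [span_fourier_closure_eq_top]; trivial
  rw [← SetLike.mem_coe, Submodule.topologicalClosure_coe, Metric.mem_closure_iff] at hcl
  have key : ∀ δ : ℝ, 0 < δ → δ < ε/2 → ∫ θ, Real.log (G (ctheta θ)) ∂(PoisM ζ) ≤
      R + Real.log (∫ θ, G (ctheta θ) ∂ν) + 2 * δ / (ε/2) := by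
    intro δ hδ hδ2
    obtain ⟨T, hT, hd⟩ := hcl δ hδ
    have hb : ∀ θ : ℝ, |G (ctheta θ) - (T (θ : AddCircle (2*π))).re| ≤ δ := by
      intro θ
      have a1 := (ContinuousMap.dist_apply_le_dist (f := GC) (g := T) (θ : AddCircle (2*π))).trans hd.le
      rw [dist_eq_norm, hGC] at a1
      have a2 := (Complex.abs_re_le_norm _).trans a1
      simpa using a2
    have hTc : Continuous fun θ : ℝ => (T (θ : AddCircle (2*π))).re :=
      Complex.continuous_re.comp (T.continuous.comp (AddCircle.continuous_mk' _))
    have hTl : ∀ θ : ℝ, ε/2 ≤ (T (θ : AddCircle (2*π))).re := fun θ => by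
      have := (abs_le.1 (hb θ)).2; linarith [h1 (ctheta θ)]
    have hTu : ∀ θ : ℝ, (T (θ : AddCircle (2*π))).re ≤ M + δ := fun θ => by
      have := (abs_le.1 (hb θ)).1; linarith [h2 (ctheta θ)]
    have hGc : Continuous fun θ : ℝ => G (ctheta θ) := hG.comp ctheta_cont
    have hint : ∀ (μ : Measure ℝ) [IsProbabilityMeasure μ],
        ∫ θ, |G (ctheta θ) - (T (θ : AddCircle (2*π))).re| ∂μ ≤ δ := by
      intro μ _
      have i1 : Integrable (fun θ : ℝ => |G (ctheta θ) - (T (θ : AddCircle (2*π))).re|) μ :=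
        int_bdd (hGc.sub hTc).abs.measurable (fun _ => abs_nonneg _) hb
      have := integral_mono i1 (integrable_const δ) hb
      simpa using this
    exact perturb (ε := ε/2) (M := M + δ) hGc.measurable hTc.measurable (by linarith)
      (fun θ => by linarith [h1 (ctheta θ)]) (fun θ => by linarith [h2 (ctheta θ)]) hTl hTu
      (hint _) (hint _)
      (G1 hζ hcirc hnt hf hR T hT _ (fun _ => rfl) (by linarith) hTl)
  refine le_of_forall_pos_le_add fun η hη => ?_
  have hm : 0 < min (ε/4) (η * ε / 4) := by positivity
  have := key _ hm ((min_le_left _ _).trans_lt (by linarith))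
  refine this.trans ?_
  gcongr
  rw [div_le_iff₀ (by linarith)]
  have := min_le_right (ε/4) (η * ε / 4)
  nlinarith

lemma Pois_circ (ζ : ℂ) : (PoisM ζ) (Ico 0 (2*π))ᶜ = 0 := by
  rw [PoisM_eq, DM_eq, withDensity_apply _ measurableSet_Ico.compl]
  rw [setLIntegral_congr_fun (g := fun _ => 0) measurableSet_Ico.compl]
  · simp
  · intro θ hθ
    simp [dmf, indicator_of_notMem hθ]

lemma G3 (hζ : ‖ζ‖ < 1) (hcirc : ν (Ico 0 (2*π))ᶜ = 0)
    (hnt : InfiniteSupport ν) (hf : IsSchurFn ν f) (hR : ∀ n, Rn ζ f n ≤ R)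
    (g : ℝ → ℝ) (ε M : ℝ) (hg : Measurable g) (hε : 0 < ε) (h1 : ∀ x, ε ≤ g x)
    (h2 : ∀ x, g x ≤ M) :
    ∫ x, Real.log (g x) ∂(PoisM ζ) ≤ R + Real.log (∫ x, g x ∂ν) := by
  have := pois_prob hζ
  refine le_of_forall_pos_le_add fun η hη => ?_
  let m : Measure ℂ := (PoisM ζ + ν).map ctheta
  have : IsFiniteMeasure m := by unfold m; infer_instance
  have hεM : ε ≤ M := (h1 0).trans (h2 0)
  have hgt : Measurable (g ∘ amap) := hg.comp amap_meas
  have hgi : Integrable (g ∘ amap) m :=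
    Integrable.of_mem_Icc ε M hgt.aemeasurable (Eventually.of_forall fun x => ⟨h1 _, h2 _⟩)
  obtain ⟨G₀, hG₀, hG₀i⟩ := hgi.exists_boundedContinuous_integral_sub_le
    (ε := η * ε / 2) (by positivity)
  let G : ℂ → ℝ := fun z => max ε (min (G₀ z) M)
  have hGc : Continuous G := continuous_const.max (G₀.continuous.min continuous_const)
  have hG1 : ∀ z, ε ≤ G z := fun z => le_max_left _ _
  have hG2 : ∀ z, G z ≤ M := fun z => max_le hεM (min_le_right _ _)
  have hcl : ∀ z, |g (amap z) - G z| ≤ ‖(g ∘ amap) z - G₀ z‖ := by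
    intro z
    have e : g (amap z) = max ε (min (g (amap z)) M) := by
      rw [min_eq_left (h2 _), max_eq_right (h1 _)]
    rw [e]
    refine (abs_max_sub_max_le_max _ _ _ _).trans ?_
    simp only [sub_self, abs_zero]
    refine max_le (norm_nonneg _) ((abs_min_sub_min_le_max _ _ _ _).trans ?_)
    simp only [sub_self, abs_zero]
    exact max_le (le_of_eq (by simp)) (norm_nonneg _)
  have hGm : Measurable fun z => |g (amap z) - G z| := by
    have := hGc.measurable
    exact (hgt.sub this).abs
  have hGi : Integrable (fun z => |g (amap z) - G z|) m :=
    Integrable.mono' (hgi.sub hG₀i).norm hGm.aestronglyMeasurable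
      (Eventually.of_forall fun z => by rw [Real.norm_eq_abs, abs_abs]; exact hcl z)
  have hm : ∫ z, |g (amap z) - G z| ∂m ≤ η * ε / 2 :=
    (integral_mono hGi (hgi.sub hG₀i).norm hcl).trans hG₀
  have hm' : Integrable (fun θ => |g (amap (ctheta θ)) - G (ctheta θ)|) (PoisM ζ + ν) :=
    hGi.comp_measurable ctheta_cont.measurable
  unfold m at hm
  rw [integral_map ctheta_cont.measurable.aemeasurable hGm.aestronglyMeasurable,
    integral_add_measure hm'.left_of_add_measure hm'.right_of_add_measure] at hm
  have tr : ∀ (μ : Measure ℝ), μ (Ico 0 (2*π))ᶜ = 0 →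
      ∫ θ, |g (amap (ctheta θ)) - G (ctheta θ)| ∂μ = ∫ θ, |g θ - G (ctheta θ)| ∂μ := by
    intro μ hμ
    apply integral_congr_ae
    have : ∀ᵐ θ ∂μ, θ ∈ Ico 0 (2*π) := hμ
    filter_upwards [this] with θ hθ
    rw [amap_ctheta hθ]
  rw [tr _ (Pois_circ ζ), tr _ hcirc] at hm
  have n1 : 0 ≤ ∫ θ, |g θ - G (ctheta θ)| ∂(PoisM ζ) := integral_nonneg fun _ => abs_nonneg _
  have n2 : 0 ≤ ∫ θ, |g θ - G (ctheta θ)| ∂ν := integral_nonneg fun _ => abs_nonneg _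
  have := perturb (δ := η * ε / 2) (R := R) hg (hGc.comp ctheta_cont).measurable hε h1 h2
    (fun θ => hG1 _) (fun θ => hG2 _) (by simpa using by linarith) (by simpa using by linarith)
    (G2 hζ hcirc hnt hf hR G hGc hε hG1 hG2)
  refine this.trans (le_of_eq ?_)
  field_simp
end

lemma H_low {ζ : ℂ} (hζ : ‖ζ‖ < 1)
    {ν : Measure ℝ} [IsProbabilityMeasure ν] (hcirc : ν (Ico 0 (2*π))ᶜ = 0)
    (hnt : InfiniteSupport ν) {f : ℂ → ℂ} (hf : IsSchurFn ν f) (n : ℕ) :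
    ENNReal.ofReal (Rn ζ f n) ≤ KLdiv (PoisM ζ) ν := by
  unfold KLdiv
  split_ifs with hc
  swap
  · exact le_top
  have := pois_prob hζ
  obtain ⟨w, hw, hw0, hw1, hw2, -⟩ := package hζ hcirc hnt hf n
  have hq : ContinuousOn (fun z => poissonKernel 0 ζ z / w z) Sph :=
    (pk_cont hζ).div hw (fun z hz => (hw0 z hz).ne')
  have hp : ∀ z ∈ Sph, 0 < poissonKernel 0 ζ z / w z := fun z hz =>
    div_pos (pk_pos hζ hz) (hw0 z hz)
  have hl := hq.log (fun z hz => (hp z hz).ne')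
  have he : ∀ θ, Real.exp (Real.log (poissonKernel 0 ζ (ctheta θ) / w (ctheta θ))) =
      poissonKernel 0 ζ (ctheta θ) / w (ctheta θ) := fun θ => Real.exp_log (hp _ (ctheta_mem θ))
  apply ENNReal.ofReal_le_ofReal
  rw [← hw1]
  refine F1 hc.1 hc.2 (intg' hl _) ?_ ?_
  · simp only [he]; exact intg' hq ν
  · simp only [he]; exact hw2.le

lemma tm_nonneg {ζ : ℂ} (hζ : ‖ζ‖ < 1) {a : ℂ} (ha : ‖a‖ < 1) :
    0 ≤ Real.log ((1 - ‖ζ * a‖^2) / (1 - ‖a‖^2)) := by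
  have h0 := norm_nonneg a
  have h1 : ‖ζ * a‖ ≤ ‖a‖ := by
    rw [norm_mul]; exact mul_le_of_le_one_left h0 hζ.le
  have h2 : 0 < 1 - ‖a‖^2 := by nlinarith
  apply Real.log_nonneg
  rw [le_div_iff₀ h2]
  have := pow_le_pow_left₀ (norm_nonneg _) h1 2
  linarith

lemma first_nonneg {ζ : ℂ} (hζ : ‖ζ‖ < 1) {a : ℂ} (ha : ‖a‖ < 1) :
    0 ≤ Real.log (‖1 - ζ * a‖^2 / ((1 - ‖ζ‖^2) * (1 - ‖a‖^2))) := by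
  have h0 := norm_nonneg a
  have h0' := norm_nonneg ζ
  have h2 : 0 < 1 - ‖a‖^2 := by nlinarith
  have h3 : 0 < 1 - ‖ζ‖^2 := by nlinarith
  apply Real.log_nonneg
  rw [le_div_iff₀ (by positivity)]
  have := moeb_id (conj ζ) a
  rw [Complex.conj_conj, RCLike.norm_conj] at this
  nlinarith [sq_nonneg ‖a - conj ζ‖]

theorem poisson_sum_rule_bessonov (ζ : ℂ) (hζ : ‖ζ‖ < 1)
    (ν : Measure ℝ) [IsProbabilityMeasure ν] (hcirc : ν (Ico 0 (2*π))ᶜ = 0)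
    (hnt : InfiniteSupport ν) (f : ℂ → ℂ) (hf : IsSchurFn ν f) :
    (∀ k : ℕ, 0 ≤ Real.log ((1 - ‖ζ * (schurStep^[k+1] f) ζ‖^2) / (1 - ‖(schurStep^[k+1] f) ζ‖^2))) ∧
    KLdiv (PoisM ζ) ν = ENNReal.ofReal (Real.log (‖1 - ζ * f ζ‖^2 / ((1 - ‖ζ‖^2) * (1 - ‖f ζ‖^2))))
      + ∑' k : ℕ, ENNReal.ofReal (Real.log ((1 - ‖ζ * (schurStep^[k+1] f) ζ‖^2) / (1 - ‖(schurStep^[k+1] f) ζ‖^2))) := by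
  have hb : ζ ∈ Metric.ball (0:ℂ) 1 := by simpa using hζ
  have ht : ∀ k : ℕ, 0 ≤ Real.log ((1 - ‖ζ * (schurStep^[k+1] f) ζ‖^2) / (1 - ‖(schurStep^[k+1] f) ζ‖^2)) :=
    fun k => tm_nonneg hζ ((str_n hcirc hnt hf (k+1)).2 ζ hb)
  have h1 := first_nonneg hζ ((str_n hcirc hnt hf 0).2 ζ hb)
  simp only [Function.iterate_zero, id] at h1
  refine ⟨ht, ?_⟩
  have hRn : ∀ n, ENNReal.ofReal (Rn ζ f n) =
      ENNReal.ofReal (Real.log (‖1 - ζ * f ζ‖^2 / ((1 - ‖ζ‖^2) * (1 - ‖f ζ‖^2)))) +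
      ∑ k ∈ Finset.range n, ENNReal.ofReal (Real.log ((1 - ‖ζ * (schurStep^[k+1] f) ζ‖^2) / (1 - ‖(schurStep^[k+1] f) ζ‖^2))) := by
    intro n
    rw [Rn]
    simp only [tm]
    rw [ENNReal.ofReal_add h1 (Finset.sum_nonneg fun k _ => ht k),
      ENNReal.ofReal_sum_of_nonneg fun k _ => ht k]
  apply le_antisymm
  · set S := ENNReal.ofReal (Real.log (‖1 - ζ * f ζ‖^2 / ((1 - ‖ζ‖^2) * (1 - ‖f ζ‖^2))))
      + ∑' k : ℕ, ENNReal.ofReal (Real.log ((1 - ‖ζ * (schurStep^[k+1] f) ζ‖^2) / (1 - ‖(schurStep^[k+1] f) ζ‖^2))) with hS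
    rcases eq_or_ne S ⊤ with hT | hT
    · rw [hT]; exact le_top
    have hR : ∀ n, Rn ζ f n ≤ S.toReal := by
      intro n
      rw [← ENNReal.ofReal_le_iff_le_toReal hT, hRn n]
      exact add_le_add le_rfl (ENNReal.sum_le_tsum _)
    have := pois_prob hζ
    obtain ⟨a1, a2, a3⟩ := F2 (P := PoisM ζ) (ν := ν) (R := S.toReal) (G3 hζ hcirc hnt hf hR)
    unfold KLdiv
    rw [if_pos ⟨a1, a2⟩]
    exact ENNReal.ofReal_le_of_le_toReal a3
  · rw [ENNReal.tsum_eq_iSup_nat, ENNReal.add_iSup]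
    refine iSup_le fun n => ?_
    rw [← hRn]
    exact H_low hζ hcirc hnt hf n

end SumRules
end
end

section
/- Kullback–Leibler divergence of mixtures: Let μ₁, μ₂ be probability measures on a measurable space S and let τ₁, τ₂ > 0 with τ₁ + τ₂ = 1. Then (i) K(μᵢ | τ₁μ₁ + τ₂μ₂) < ∞ for i = 1, 2; and (ii) for any probability measure μ on S, K(τ₁μ₁ + τ₂μ₂ | μ) = τ₁·K(μ₁ | μ) + τ₂·K(μ₂ | μ) − τ₁·K(μ₁ | τ₁μ₁ + τ₂μ₂) − τ₂·K(μ₂ | τ₁μ₁ + τ₂μ₂), where both sides are simultaneously finite or infinite. -/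
open MeasureTheory Real Filter Set Topology Polynomial
open scoped ENNReal ComplexConjugate

noncomputable section

namespace SumRules

open InformationTheory

theorem KLdiv_eq_klDiv {S : Type*} [MeasurableSpace S] (ν μ : Measure S)
    [IsProbabilityMeasure ν] [IsProbabilityMeasure μ] : KLdiv ν μ = klDiv ν μ := by
  rw [klDiv_def]
  simp [KLdiv]

theorem klFun_mul_aux (f g : ℝ) (hf : 0 ≤ f) (hg : 0 ≤ g) :
    klFun (g * f) = f * klFun g + g * f * Real.log f + 1 - f := by
  rcases hf.eq_or_lt with rfl | hf
  · simp [klFun]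
  rcases hg.eq_or_lt with rfl | hg
  · simp [klFun]
  rw [klFun, klFun, Real.log_mul hg.ne' hf.ne']
  ring

theorem klFun_mix (t₁ t₂ f f₁ f₂ g₁ g₂ : ℝ) (hs : t₁ + t₂ = 1) (hf : 0 ≤ f)
    (hg₁ : 0 ≤ g₁) (hg₂ : 0 ≤ g₂) (e₁ : g₁ * f = f₁) (e₂ : g₂ * f = f₂)
    (e : f = t₁ * f₁ + t₂ * f₂) :
    klFun f + t₁ * (f * klFun g₁) + t₂ * (f * klFun g₂) = t₁ * klFun f₁ + t₂ * klFun f₂ := by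
  rw [← e₁, ← e₂, klFun_mul_aux f g₁ hf hg₁, klFun_mul_aux f g₂ hf hg₂, klFun]
  rw [← e₁, ← e₂] at e
  linear_combination (Real.log f) * e + (f - 1) * hs

theorem rnDeriv_mix {S : Type*} [MeasurableSpace S] (μ₁ μ₂ μ : Measure S)
    [IsProbabilityMeasure μ₁] [IsProbabilityMeasure μ₂] [IsProbabilityMeasure μ]
    (τ₁ τ₂ : ℝ) :
    (ENNReal.ofReal τ₁ • μ₁ + ENNReal.ofReal τ₂ • μ₂).rnDeriv μ =ᵐ[μ]
      fun x => ENNReal.ofReal τ₁ * μ₁.rnDeriv μ x + ENNReal.ofReal τ₂ * μ₂.rnDeriv μ x := by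
  have i₁ : IsFiniteMeasure (ENNReal.ofReal τ₁ • μ₁) := Measure.smul_finite _ ENNReal.ofReal_ne_top
  have i₂ : IsFiniteMeasure (ENNReal.ofReal τ₂ • μ₂) := Measure.smul_finite _ ENNReal.ofReal_ne_top
  filter_upwards [Measure.rnDeriv_add (ENNReal.ofReal τ₁ • μ₁) (ENNReal.ofReal τ₂ • μ₂) μ,
    Measure.rnDeriv_smul_left_of_ne_top μ₁ μ (r := ENNReal.ofReal τ₁) ENNReal.ofReal_ne_top,
    Measure.rnDeriv_smul_left_of_ne_top μ₂ μ (r := ENNReal.ofReal τ₂) ENNReal.ofReal_ne_top]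
    with x a b c
  rw [a, Pi.add_apply, b, c]
  rfl

theorem klDiv_ne_top_of_bound {S : Type*} [MeasurableSpace S] (ν m : Measure S)
    [IsProbabilityMeasure ν] [IsProbabilityMeasure m] (hac : ν ≪ m) (t : ℝ) (ht : 0 < t)
    (hb : ∀ᵐ x ∂m, ENNReal.ofReal t * ν.rnDeriv m x ≤ 1) : klDiv ν m ≠ ⊤ := by
  rw [klDiv_eq_lintegral_klFun_of_ac hac]
  refine ne_top_of_le_ne_top (b := ∫⁻ _, ENNReal.ofReal (1 + (1 / t) ^ 2) ∂m) (by simp) ?_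
  refine lintegral_mono_ae ?_
  filter_upwards [hb] with x hx
  apply ENNReal.ofReal_le_ofReal
  set y := (ν.rnDeriv m x).toReal with hy
  have hy0 : 0 ≤ y := ENNReal.toReal_nonneg
  have h : t * y ≤ 1 := by
    have := ENNReal.toReal_mono ENNReal.one_ne_top hx
    simpa [ENNReal.toReal_mul, ENNReal.toReal_ofReal ht.le] using this
  have h' : y ≤ 1 / t := by rw [le_div_iff₀ ht]; linarith
  have h3 : y * Real.log y ≤ y * y := by
    apply mul_le_mul_of_nonneg_left _ hy0
    exact Real.log_le_self hy0
  rw [klFun]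
  nlinarith [pow_le_pow_left₀ hy0 h' 2]

/-- Kullback–Leibler divergences of mixtures.  The identity
`K(τ₁μ₁+τ₂μ₂ | μ) = τ₁K(μ₁|μ) + τ₂K(μ₂|μ) - τ₁K(μ₁|mix) - τ₂K(μ₂|mix)` is stated
with the (finite, by part (i)) subtracted terms moved to the left-hand side, so that
both sides are simultaneously finite or infinite. -/
theorem kl_divergence_mixture {S : Type*} [MeasurableSpace S] (μ₁ μ₂ μ : Measure S)
    [IsProbabilityMeasure μ₁] [IsProbabilityMeasure μ₂] [IsProbabilityMeasure μ]
    (τ₁ τ₂ : ℝ) (h1 : 0 < τ₁) (h2 : 0 < τ₂) (hsum : τ₁ + τ₂ = 1) :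
    KLdiv μ₁ (ENNReal.ofReal τ₁ • μ₁ + ENNReal.ofReal τ₂ • μ₂) ≠ ⊤ ∧
    KLdiv μ₂ (ENNReal.ofReal τ₁ • μ₁ + ENNReal.ofReal τ₂ • μ₂) ≠ ⊤ ∧
    KLdiv (ENNReal.ofReal τ₁ • μ₁ + ENNReal.ofReal τ₂ • μ₂) μ
      + ENNReal.ofReal τ₁ * KLdiv μ₁ (ENNReal.ofReal τ₁ • μ₁ + ENNReal.ofReal τ₂ • μ₂)
      + ENNReal.ofReal τ₂ * KLdiv μ₂ (ENNReal.ofReal τ₁ • μ₁ + ENNReal.ofReal τ₂ • μ₂)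
      = ENNReal.ofReal τ₁ * KLdiv μ₁ μ + ENNReal.ofReal τ₂ * KLdiv μ₂ μ := by
  have hs' : ENNReal.ofReal τ₁ + ENNReal.ofReal τ₂ = 1 := by
    rw [← ENNReal.ofReal_add h1.le h2.le, hsum, ENNReal.ofReal_one]
  have p1 : ENNReal.ofReal τ₁ ≠ 0 := by simpa using h1
  have p2 : ENNReal.ofReal τ₂ ≠ 0 := by simpa using h2
  have hm := fun κ : Measure S => fun [IsProbabilityMeasure κ] => rnDeriv_mix μ₁ μ₂ κ τ₁ τ₂
  have hac1 : μ₁ ≪ ENNReal.ofReal τ₁ • μ₁ + ENNReal.ofReal τ₂ • μ₂ :=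
    (Measure.absolutelyContinuous_smul p1).trans (Measure.le_add_right le_rfl).absolutelyContinuous
  have hac2 : μ₂ ≪ ENNReal.ofReal τ₁ • μ₁ + ENNReal.ofReal τ₂ • μ₂ :=
    (Measure.absolutelyContinuous_smul p2).trans (Measure.le_add_left le_rfl).absolutelyContinuous
  have hacm : μ₁ ≪ μ → μ₂ ≪ μ → ENNReal.ofReal τ₁ • μ₁ + ENNReal.ofReal τ₂ • μ₂ ≪ μ := by
    intro a b s hs
    simp [a hs, b hs]
  have hp : IsProbabilityMeasure (ENNReal.ofReal τ₁ • μ₁ + ENNReal.ofReal τ₂ • μ₂) :=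
    ⟨by simpa using hs'⟩
  generalize ENNReal.ofReal τ₁ • μ₁ + ENNReal.ofReal τ₂ • μ₂ = m at *
  have hself := (hm m).symm.trans (Measure.rnDeriv_self m)
  simp only [KLdiv_eq_klDiv]
  have n1 : klDiv μ₁ m ≠ ⊤ := by
    refine klDiv_ne_top_of_bound μ₁ m hac1 τ₁ h1 ?_
    filter_upwards [hself] with x hx
    exact le_self_add.trans hx.le
  have n2 : klDiv μ₂ m ≠ ⊤ := by
    refine klDiv_ne_top_of_bound μ₂ m hac2 τ₂ h2 ?_
    filter_upwards [hself] with x hx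
    exact le_add_self.trans hx.le
  refine ⟨n1, n2, ?_⟩
  by_cases hmμ : m ≪ μ
  · rw [klDiv_eq_lintegral_klFun_of_ac hmμ, klDiv_eq_lintegral_klFun_of_ac hac1,
      klDiv_eq_lintegral_klFun_of_ac hac2, klDiv_eq_lintegral_klFun_of_ac (hac1.trans hmμ),
      klDiv_eq_lintegral_klFun_of_ac (hac2.trans hmμ),
      ← lintegral_rnDeriv_mul hmμ (by fun_prop), ← lintegral_rnDeriv_mul hmμ (by fun_prop),
      ← lintegral_const_mul _ (by fun_prop), ← lintegral_const_mul _ (by fun_prop),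
      ← lintegral_const_mul _ (by fun_prop), ← lintegral_const_mul _ (by fun_prop),
      ← lintegral_add_left (by fun_prop), ← lintegral_add_left (by fun_prop),
      ← lintegral_add_left (by fun_prop)]
    refine lintegral_congr_ae ?_
    filter_upwards [hm μ, Measure.rnDeriv_mul_rnDeriv hac1 (κ := μ),
      Measure.rnDeriv_mul_rnDeriv hac2 (κ := μ), Measure.rnDeriv_lt_top m μ,
      Measure.rnDeriv_lt_top μ₁ μ, Measure.rnDeriv_lt_top μ₂ μ] with x e e1 e2 l l1 l2
    have k0 : ∀ y : ℝ≥0∞, 0 ≤ klFun y.toReal := fun y => klFun_nonneg ENNReal.toReal_nonneg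
    have key := klFun_mix τ₁ τ₂ (m.rnDeriv μ x).toReal (μ₁.rnDeriv μ x).toReal
      (μ₂.rnDeriv μ x).toReal (μ₁.rnDeriv m x).toReal (μ₂.rnDeriv m x).toReal hsum
      ENNReal.toReal_nonneg ENNReal.toReal_nonneg ENNReal.toReal_nonneg
      (by rw [← e1, Pi.mul_apply, ENNReal.toReal_mul])
      (by rw [← e2, Pi.mul_apply, ENNReal.toReal_mul])
      (by rw [e, ENNReal.toReal_add (by finiteness) (by finiteness), ENNReal.toReal_mul,
            ENNReal.toReal_mul, ENNReal.toReal_ofReal h1.le, ENNReal.toReal_ofReal h2.le])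
    have hl : m.rnDeriv μ x = ENNReal.ofReal (m.rnDeriv μ x).toReal :=
      (ENNReal.ofReal_toReal l.ne).symm
    have q1 := mul_nonneg (ENNReal.toReal_nonneg (a := m.rnDeriv μ x)) (k0 (μ₁.rnDeriv m x))
    have q2 := mul_nonneg (ENNReal.toReal_nonneg (a := m.rnDeriv μ x)) (k0 (μ₂.rnDeriv m x))
    have key' := congrArg ENNReal.ofReal key
    rw [ENNReal.ofReal_add (add_nonneg (k0 _) (mul_nonneg h1.le q1)) (mul_nonneg h2.le q2),
      ENNReal.ofReal_add (k0 _) (mul_nonneg h1.le q1),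
      ENNReal.ofReal_add (mul_nonneg h1.le (k0 _)) (mul_nonneg h2.le (k0 _)),
      ENNReal.ofReal_mul h1.le, ENNReal.ofReal_mul h2.le, ENNReal.ofReal_mul h1.le,
      ENNReal.ofReal_mul h2.le, ENNReal.ofReal_mul ENNReal.toReal_nonneg,
      ENNReal.ofReal_mul ENNReal.toReal_nonneg, ENNReal.ofReal_toReal l.ne] at key'
    exact key'
  · rw [klDiv_of_not_ac hmμ, top_add, top_add]
    by_cases ha : μ₁ ≪ μ
    · have hb : ¬ μ₂ ≪ μ := fun hb => hmμ (hacm ha hb)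
      rw [klDiv_of_not_ac hb, ENNReal.mul_top p2, add_top]
    · rw [klDiv_of_not_ac ha, ENNReal.mul_top p1, top_add]

end SumRules
end
end

section
/- Szegő pushforward of the Hua–Pickrell measure: Let d > 0. The pushforward of HP(d) under the Szegő map e^{iθ} ↦ 2·cos θ is the Kesten–McKay law KMK(2d,0), i.e. the measure with density ((1+d)/π)·√((x_d − x)(2+x))/(4−x²) on (−2, x_d), where x_d = 2(1+2d−d²)/(1+d)². -/
open MeasureTheory Real Filter Set Topology Polynomial
open scoped ENNReal ComplexConjugate

noncomputable section

namespace SumRules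

lemma thetaD_facts (d : ℝ) (hd : 0 < d) :
    0 < thetaD d ∧ thetaD d < π ∧ Real.sin (thetaD d / 2) = d/(1+d) ∧
      2 * Real.cos (thetaD d) = xdHP d := by
  have h0 : 0 < d/(1+d) := by positivity
  have h1 : d/(1+d) < 1 := by rw [div_lt_one (by positivity)]; linarith
  have hs : Real.sin (thetaD d / 2) = d/(1+d) := by
    unfold thetaD
    rw [mul_div_cancel_left₀ _ (by norm_num : (2:ℝ) ≠ 0)]
    exact Real.sin_arcsin (by linarith) h1.le
  refine ⟨?_, ?_, hs, ?_⟩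
  · unfold thetaD; have := Real.arcsin_pos.2 h0; linarith
  · unfold thetaD; have := Real.arcsin_lt_pi_div_two.2 h1; linarith
  · have : Real.cos (thetaD d) = 1 - 2 * Real.sin (thetaD d / 2)^2 := by
      have h := Real.cos_sq' (thetaD d / 2)
      have h2 := Real.cos_two_mul (thetaD d / 2)
      rw [show 2 * (thetaD d / 2) = thetaD d by ring] at h2
      linarith
    rw [this, hs]; unfold xdHP; field_simp; ring

/-- the target density -/
def Gd (d x : ℝ) : ℝ := (1+d)/π * Real.sqrt ((xdHP d - x) * (2 + x)) / (4 - x^2)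

lemma pointwise (d : ℝ) (hd : 0 < d) (θ : ℝ) (h1 : thetaD d < θ) (h2 : θ < 2*π - thetaD d)
    (h3 : θ ≠ π) :
    (1+d) * Real.sqrt (Real.sin (θ/2)^2 - Real.sin (thetaD d/2)^2) / (2*π*Real.sin (θ/2)) =
      |(-(2 * Real.sin θ))| * (Gd d (2 * Real.cos θ) / 2) := by
  obtain ⟨t0, t1, hs, hc⟩ := thetaD_facts d hd
  have hsp : 0 < Real.sin (θ/2) := Real.sin_pos_of_pos_of_lt_pi (by linarith) (by linarith)
  have hcn : Real.cos (θ/2) ≠ 0 := by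
    intro h
    rw [← Real.cos_pi_div_two] at h
    have := Real.injOn_cos (x₁ := θ/2) (x₂ := π/2) ⟨by linarith, by linarith⟩
      ⟨by linarith, by linarith⟩ h
    exact h3 (by linarith)
  have e1 : Real.sin θ = 2 * Real.sin (θ/2) * Real.cos (θ/2) := by
    rw [← Real.sin_two_mul]; ring_nf
  have e2 : ∀ t, Real.cos t = 1 - 2 * Real.sin (t/2)^2 := by
    intro t
    have h := Real.cos_sq' (t / 2)
    have h2 := Real.cos_two_mul (t / 2)
    rw [show 2 * (t / 2) = t by ring] at h2
    linarith
  have hcs := Real.cos_sq' (θ/2)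
  unfold Gd
  have e3 : (xdHP d - 2 * Real.cos θ) * (2 + 2 * Real.cos θ) =
      (4 * |Real.cos (θ/2)|)^2 * (Real.sin (θ/2)^2 - Real.sin (thetaD d/2)^2) := by
    rw [mul_pow, sq_abs, hcs, ← hc, e2 θ, e2 (thetaD d)]; ring
  have e4 : 4 - (2 * Real.cos θ)^2 = 16 * Real.sin (θ/2)^2 * |Real.cos (θ/2)|^2 := by
    rw [sq_abs, hcs, e2 θ]; ring
  rw [e3, e4, Real.sqrt_mul (by positivity), Real.sqrt_sq (by positivity), e1, abs_neg,
    abs_mul, abs_mul, abs_mul, abs_of_pos hsp, abs_of_pos (by norm_num : (0:ℝ) < 2)]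
  have : |Real.cos (θ/2)| ≠ 0 := abs_ne_zero.2 hcn
  field_simp
  ring

lemma piece (d : ℝ) (A : Set ℝ) (hA : MeasurableSet A) (h : ℝ → ℝ)
    (hinj : InjOn (fun θ => 2 * Real.cos θ) A)
    (him : (fun θ => 2 * Real.cos θ) '' A = Ioo (-2) (xdHP d))
    (hp : ∀ θ ∈ A, h θ = |(-(2 * Real.sin θ))| * (Gd d (2 * Real.cos θ) / 2))
    (s : Set ℝ) (hs : MeasurableSet s) :
    ∫⁻ θ in A ∩ (fun θ => 2 * Real.cos θ) ⁻¹' s, ENNReal.ofReal (h θ) =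
      ∫⁻ x in Ioo (-2) (xdHP d) ∩ s, ENNReal.ofReal (Gd d x / 2) := by
  have hm : Measurable (fun θ : ℝ => 2 * Real.cos θ) := by fun_prop
  have hM : MeasurableSet (A ∩ (fun θ => 2 * Real.cos θ) ⁻¹' s) := hA.inter (hm hs)
  rw [← him, ← image_inter_preimage,
    lintegral_image_eq_lintegral_abs_deriv_mul hM (f' := fun θ => -(2 * Real.sin θ))
      _ (hinj.mono inter_subset_left)]
  · refine setLIntegral_congr_fun hM ?_
    intro θ hθ
    simp only
    rw [hp θ hθ.1, ENNReal.ofReal_mul (abs_nonneg _)]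
  · intro θ _
    have := ((Real.hasDerivAt_cos θ).const_mul 2).hasDerivWithinAt
      (s := A ∩ (fun θ => 2 * Real.cos θ) ⁻¹' s)
    rw [mul_neg] at this; exact this

/-- Szegő pushforward of the Hua–Pickrell measure is the Kesten–McKay law `KMK(2d,0)`. -/
theorem szego_pushforward_HP (d : ℝ) (hd : 0 < d) :
    (HPm d).map (fun θ => 2 * Real.cos θ) =
      volume.withDensity fun x =>
        ENNReal.ofReal ((1+d)/π * Real.sqrt ((xdHP d - x) * (2 + x)) / (4 - x^2)) := by
  obtain ⟨t0, t1, hsin, hc⟩ := thetaD_facts d hd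
  have hm : Measurable (fun θ : ℝ => 2 * Real.cos θ) := by fun_prop
  have hx2 : xdHP d < 2 := by
    have := Real.strictAntiOn_cos (a := 0) (b := thetaD d) ⟨le_rfl, Real.pi_pos.le⟩
      ⟨t0.le, t1.le⟩ t0
    linarith [Real.cos_zero]
  have hxm : -2 < xdHP d := by
    have := Real.strictAntiOn_cos (a := thetaD d) (b := π) ⟨t0.le, t1.le⟩ 
      ⟨Real.pi_pos.le, le_rfl⟩ t1
    rw [Real.cos_pi] at this
    linarith
  have injA : InjOn (fun θ => 2 * Real.cos θ) (Ioo (thetaD d) π) := by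
    intro a ha b hb hab
    exact Real.injOn_cos ⟨by linarith [ha.1], ha.2.le⟩ ⟨by linarith [hb.1], hb.2.le⟩
      (by simp only at hab; linarith)
  have imA : (fun θ => 2 * Real.cos θ) '' (Ioo (thetaD d) π) = Ioo (-2) (xdHP d) := by
    ext x
    constructor
    · rintro ⟨θ, hθ, rfl⟩
      have a1 := Real.strictAntiOn_cos (a := thetaD d) (b := θ) ⟨t0.le, t1.le⟩
        ⟨by linarith [hθ.1], hθ.2.le⟩ hθ.1
      have a2 := Real.strictAntiOn_cos (a := θ) (b := π) 
        ⟨by linarith [hθ.1], hθ.2.le⟩ ⟨Real.pi_pos.le, le_rfl⟩ hθ.2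
      rw [Real.cos_pi] at a2
      constructor <;> simp only <;> linarith
    · rintro ⟨h1, h2⟩
      have hcx : Real.cos (Real.arccos (x/2)) = x/2 :=
        Real.cos_arccos (by linarith) (by linarith)
      refine ⟨Real.arccos (x/2), ⟨?_, ?_⟩, ?_⟩
      · by_contra hcon
        have := Real.strictAntiOn_cos.antitoneOn (a := Real.arccos (x/2)) (b := thetaD d)
          ⟨Real.arccos_nonneg _, Real.arccos_le_pi _⟩ ⟨t0.le, t1.le⟩ (not_lt.1 hcon)
        rw [hcx] at this
        linarith
      · refine lt_of_le_of_ne (Real.arccos_le_pi _) ?_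
        intro h
        rw [h, Real.cos_pi] at hcx
        linarith
      · simp only; rw [hcx]; ring
  have hcr : ∀ θ, Real.cos (2 * π - θ) = Real.cos θ := Real.cos_two_pi_sub
  have injB : InjOn (fun θ => 2 * Real.cos θ) (Ioo π (2 * π - thetaD d)) := by
    intro a ha b hb hab
    have := injA (x₁ := 2 * π - a) ⟨by linarith [ha.2], by linarith [ha.1]⟩ 
      (x₂ := 2 * π - b) ⟨by linarith [hb.2], by linarith [hb.1]⟩ 
      (by simpa only [hcr] using hab)
    linarith
  have imB : (fun θ => 2 * Real.cos θ) '' (Ioo π (2 * π - thetaD d)) = Ioo (-2) (xdHP d) := by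
    rw [← imA]
    ext x
    constructor
    · rintro ⟨θ, hθ, rfl⟩
      exact ⟨2 * π - θ, ⟨by linarith [hθ.2], by linarith [hθ.1]⟩, by simp only [hcr]⟩
    · rintro ⟨θ, hθ, rfl⟩
      exact ⟨2 * π - θ, ⟨by linarith [hθ.2], by linarith [hθ.1]⟩, by simp only [hcr]⟩
  set h : ℝ → ℝ := fun θ =>
    (1+d) * Real.sqrt (Real.sin (θ/2)^2 - Real.sin (thetaD d/2)^2) / (2*π*Real.sin (θ/2)) with hh
  ext s hs
  rw [Measure.map_apply hm hs, HPm, withDensity_apply _ (hm hs), withDensity_apply _ hs]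
  have L : ∀ θ, ENNReal.ofReal (
    if thetaD d < θ ∧ θ < 2*π - thetaD d then
      (1+d) * Real.sqrt (Real.sin (θ/2)^2 - Real.sin (thetaD d/2)^2) / (2*π*Real.sin (θ/2))
    else 0) = (Ioo (thetaD d) (2*π - thetaD d)).indicator (fun θ => ENNReal.ofReal (h θ)) θ := by
    intro θ
    by_cases hθ : thetaD d < θ ∧ θ < 2*π - thetaD d
    · rw [if_pos hθ, indicator_of_mem (by exact hθ)]
    · rw [if_neg hθ, indicator_of_notMem (by exact hθ), ENNReal.ofReal_zero]
  have R : ∀ x, ENNReal.ofReal ((1+d)/π * Real.sqrt ((xdHP d - x) * (2 + x)) / (4 - x^2)) =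
      (Ioo (-2) (xdHP d)).indicator (fun x => ENNReal.ofReal (Gd d x / 2) +
        ENNReal.ofReal (Gd d x / 2)) x := by
    intro x
    by_cases hx : x ∈ Ioo (-2) (xdHP d)
    · rw [indicator_of_mem hx]
      have : 0 ≤ Gd d x := by
        unfold Gd
        have : 0 < 4 - x^2 := by nlinarith [hx.1, hx.2]
        positivity
      rw [← ENNReal.ofReal_add (by linarith) (by linarith), add_halves]
      rfl
    · rw [indicator_of_notMem hx, Real.sqrt_eq_zero_of_nonpos]
      · simp
      · rcases le_or_gt x (-2) with h1 | h1
        · exact mul_nonpos_of_nonneg_of_nonpos (by linarith) (by linarith)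
        · have : xdHP d ≤ x := by
            by_contra h2
            exact hx ⟨h1, not_le.1 h2⟩
          exact mul_nonpos_of_nonpos_of_nonneg (by linarith) (by linarith)
  simp_rw [L, R]
  rw [setLIntegral_indicator measurableSet_Ioo, setLIntegral_indicator measurableSet_Ioo]
  have hGm : Measurable (fun x => ENNReal.ofReal (Gd d x / 2)) := by
    unfold Gd; fun_prop
  rw [lintegral_add_left hGm]
  have ae : (Ioo (thetaD d) (2*π - thetaD d) ∩ (fun θ => 2 * Real.cos θ) ⁻¹' s : Set ℝ) =ᵐ[volume]
      ((Ioo (thetaD d) π ∩ (fun θ => 2 * Real.cos θ) ⁻¹' s) ∪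
        (Ioo π (2*π - thetaD d) ∩ (fun θ => 2 * Real.cos θ) ⁻¹' s) : Set ℝ) := by
    have : ∀ᵐ θ ∂(volume : Measure ℝ), θ ≠ π := by simp [ae_iff]
    filter_upwards [this] with θ hθ
    apply propext
    change (_ ∧ _) ↔ ((_ ∧ _) ∨ (_ ∧ _))
    simp only [mem_Ioo]
    rcases lt_or_gt_of_ne hθ with h | h
    · constructor
      · rintro ⟨⟨a, b⟩, c⟩; exact Or.inl ⟨⟨a, h⟩, c⟩
      · rintro (⟨⟨a, b⟩, c⟩ | ⟨⟨a, b⟩, c⟩)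
        · exact ⟨⟨a, by linarith⟩, c⟩
        · exact ⟨⟨by linarith, b⟩, c⟩
    · constructor
      · rintro ⟨⟨a, b⟩, c⟩; exact Or.inr ⟨⟨h, b⟩, c⟩
      · rintro (⟨⟨a, b⟩, c⟩ | ⟨⟨a, b⟩, c⟩)
        · exact ⟨⟨a, by linarith⟩, c⟩
        · exact ⟨⟨by linarith, b⟩, c⟩
  rw [setLIntegral_congr ae, lintegral_union (measurableSet_Ioo.inter (hm hs))]
  · rw [piece d _ measurableSet_Ioo h injA imA ?_ s hs, piece d _ measurableSet_Ioo h injB imB ?_ s hs]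
    · intro θ hθ
      exact pointwise d hd θ (by linarith [hθ.1]) hθ.2 hθ.1.ne'
    · intro θ hθ
      exact pointwise d hd θ hθ.1 (by linarith [hθ.2]) hθ.2.ne
  · rw [Set.disjoint_left]
    rintro θ ⟨h1, _⟩ ⟨h2, _⟩
    exact lt_asymm h1.2 h2.1

end SumRules
end
end

section
/- Delsarte–Genin pushforward of the Hua–Pickrell measure: Let d > 0. The pushforward of HP(d) under the map e^{iθ} ↦ 2·cos(θ/2), θ ∈ [0,2π), is the symmetric Kesten–McKay law KMK(d), i.e. the measure with density ((1+d)/π)·√(u²−x²)/(4−x²) on (−u, u), where u = 2√(1+2d)/(1+d). -/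
open MeasureTheory Real Filter Set Topology Polynomial
open scoped ENNReal ComplexConjugate

noncomputable section

namespace SumRules

lemma aux_u (d : ℝ) (hd : 0 < d) : (uKMK d)^2 = 4 * (1 - (d/(1+d))^2) := by
  unfold uKMK
  rw [div_pow, mul_pow, Real.sq_sqrt (by linarith)]
  field_simp
  ring

lemma aux_s (d : ℝ) (hd : 0 < d) : Real.sin (thetaD d/2) = d/(1+d) := by
  have h0 : 0 < d/(1+d) := by positivity
  have h1 : d/(1+d) < 1 := by rw [div_lt_one (by linarith)]; linarith
  unfold thetaD
  rw [show 2 * Real.arcsin (d/(1+d)) / 2 = Real.arcsin (d/(1+d)) by ring]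
  exact Real.sin_arcsin (by linarith) h1.le

lemma aux_dens (d : ℝ) (hd : 0 < d) (θ : ℝ) (hθ : θ ∈ Ioo 0 (2*π)) :
    (if thetaD d < θ ∧ θ < 2*π - thetaD d then
      (1+d) * Real.sqrt (Real.sin (θ/2)^2 - Real.sin (thetaD d/2)^2) / (2*π*Real.sin (θ/2))
    else 0) = |-Real.sin (θ/2)| *
      ((1+d)/π * Real.sqrt ((uKMK d)^2 - (2 * Real.cos (θ/2))^2) / (4 - (2 * Real.cos (θ/2))^2)) := by
  have hs : 0 < Real.sin (θ/2) := Real.sin_pos_of_pos_of_lt_pi (by linarith [hθ.1]) (by linarith [hθ.2])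
  have hpi := Real.pi_pos
  have hsD := aux_s d hd
  have h0 : 0 < d/(1+d) := by positivity
  have e1 : (uKMK d)^2 - (2 * Real.cos (θ/2))^2
      = 2^2 * (Real.sin (θ/2)^2 - Real.sin (thetaD d/2)^2) := by
    rw [aux_u d hd, hsD, Real.sin_sq]; ring
  have e2 : 4 - (2 * Real.cos (θ/2))^2 = 4 * Real.sin (θ/2)^2 := by
    rw [Real.sin_sq]; ring
  rw [e1, e2, abs_neg, abs_of_pos hs, Real.sqrt_mul (by norm_num), Real.sqrt_sq (by norm_num)]
  split_ifs with h
  · field_simp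
    ring
  · have hle : Real.sin (θ/2) ≤ Real.sin (thetaD d/2) := by
      have hD : thetaD d / 2 ≤ π/2 := by
        unfold thetaD
        linarith [Real.arcsin_le_pi_div_two (d/(1+d))]
      rcases not_and_or.mp h with h | h
      · exact Real.sin_le_sin_of_le_of_le_pi_div_two (by linarith [hθ.1]) hD (by linarith)
      · rw [← Real.sin_pi_sub (θ/2)]
        exact Real.sin_le_sin_of_le_of_le_pi_div_two (by linarith [hθ.2]) hD (by linarith)
    have : Real.sqrt (Real.sin (θ/2)^2 - Real.sin (thetaD d/2)^2) = 0 :=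
      Real.sqrt_eq_zero_of_nonpos (by nlinarith)
    simp [this]

lemma aux_out (d : ℝ) (hd : 0 < d) (x : ℝ)
    (hx : x ∉ (fun θ : ℝ => 2 * Real.cos (θ/2)) '' Ioo 0 (2*π)) :
    ENNReal.ofReal ((1+d)/π * Real.sqrt ((uKMK d)^2 - x^2) / (4 - x^2)) = 0 := by
  have h4 : 4 ≤ x^2 := by
    by_contra hc
    apply hx
    have h1 : -2 < x := by nlinarith
    have h2 : x < 2 := by nlinarith
    refine ⟨2 * Real.arccos (x/2), ⟨?_, ?_⟩, ?_⟩
    · have := Real.arccos_pos.mpr (show x/2 < 1 by linarith)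
      linarith
    · have : Real.arccos (x/2) < π := by
        refine lt_of_le_of_ne (Real.arccos_le_pi _) ?_
        rw [Ne, Real.arccos_eq_pi]
        linarith
      linarith
    · simp only
      rw [show 2 * Real.arccos (x/2) / 2 = Real.arccos (x/2) by ring,
        Real.cos_arccos (by linarith) (by linarith)]
      ring
  have : Real.sqrt ((uKMK d)^2 - x^2) = 0 := by
    apply Real.sqrt_eq_zero_of_nonpos
    rw [aux_u d hd]
    nlinarith [sq_nonneg (d/(1+d))]
  simp [this]

/-- Delsarte–Genin pushforward of the Hua–Pickrell measure is the symmetric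
Kesten–McKay law `KMK(d)`. -/
theorem dg_pushforward_HP (d : ℝ) (hd : 0 < d) :
    (HPm d).map (fun θ => 2 * Real.cos (θ/2)) =
      volume.withDensity fun x =>
        ENNReal.ofReal ((1+d)/π * Real.sqrt ((uKMK d)^2 - x^2) / (4 - x^2)) := by
  set f : ℝ → ℝ := fun θ => 2 * Real.cos (θ/2) with hf
  set g : ℝ → ℝ≥0∞ := fun x =>
        ENNReal.ofReal ((1+d)/π * Real.sqrt ((uKMK d)^2 - x^2) / (4 - x^2)) with hg
  have hfm : Measurable f := by fun_prop
  have hD0 : 0 ≤ thetaD d := by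
    unfold thetaD
    have := Real.arcsin_nonneg.mpr (show 0 ≤ d/(1+d) by positivity)
    linarith
  have hder : ∀ x ∈ Ioo (0:ℝ) (2*π),
      HasDerivWithinAt f (-Real.sin (x/2)) (Ioo (0:ℝ) (2*π)) x := by
    intro x _
    have h : HasDerivAt f (2 * (-Real.sin (x/2) * (1/2))) x :=
      (((hasDerivAt_id x).div_const 2).cos).const_mul 2
    refine HasDerivAt.hasDerivWithinAt ?_
    rwa [show 2 * (-Real.sin (x/2) * (1/2)) = -Real.sin (x/2) by ring] at h
  have hinj : InjOn f (Ioo (0:ℝ) (2*π)) := by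
    intro x hx y hy hxy
    have h1 : Real.cos (x/2) = Real.cos (y/2) := by
      simp only [hf] at hxy
      linarith
    have := Real.injOn_cos ⟨by linarith [hx.1], by linarith [hx.2]⟩
      ⟨by linarith [hy.1], by linarith [hy.2]⟩ h1
    linarith
  have himg : MeasurableSet (f '' Ioo (0:ℝ) (2*π)) :=
    measurableSet_Ioo.image_of_continuousOn_injOn (by fun_prop) hinj
  ext A hA
  rw [Measure.map_apply hfm hA, HPm, withDensity_apply _ (hfm hA), withDensity_apply _ hA,
    ← lintegral_indicator (hfm hA), ← lintegral_indicator hA]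
  have hR : ∫⁻ x, A.indicator g x = ∫⁻ x in f '' Ioo (0:ℝ) (2*π), A.indicator g x := by
    rw [← lintegral_indicator himg]
    congr 1
    ext x
    by_cases hx : x ∈ f '' Ioo (0:ℝ) (2*π)
    · rw [indicator_of_mem hx]
    · rw [indicator_of_notMem hx]
      by_cases hxA : x ∈ A
      · rw [indicator_of_mem hxA]
        exact aux_out d hd x hx
      · rw [indicator_of_notMem hxA]
  rw [hR, lintegral_image_eq_lintegral_abs_deriv_mul measurableSet_Ioo hder hinj,
    ← lintegral_indicator measurableSet_Ioo]
  congr 1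
  ext θ
  by_cases hθ : θ ∈ Ioo (0:ℝ) (2*π)
  · rw [indicator_of_mem hθ]
    by_cases hA' : f θ ∈ A
    · rw [indicator_of_mem (show θ ∈ f ⁻¹' A from hA'), indicator_of_mem hA',
        aux_dens d hd θ hθ, ENNReal.ofReal_mul (abs_nonneg _)]
    · rw [indicator_of_notMem (show θ ∉ f ⁻¹' A from hA'), indicator_of_notMem hA', mul_zero]
  · rw [indicator_of_notMem hθ]
    have : ¬ (thetaD d < θ ∧ θ < 2*π - thetaD d) := by
      rintro ⟨h1, h2⟩
      exact hθ ⟨by linarith, by linarith⟩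
    simp [indicator, this]

end SumRules
end
end
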